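/- arXiv:1410.3244 — 2 statements merged into one kernel-verified Lean document; each statement's English description precedes it below -/
import Mathlib

section
/- For every r ∈ {3, 5, 6, 7} and every integer t ≥ 0, no pseudo H-type Lie algebra n_{r+8t,0} built on a minimal admissible Cl_{r+8t,0}-module is isomorphic as a Lie algebra to a pseudo H-type Lie algebra n_{0,r+8t} built on a minimal admissible Cl_{0,r+8t}-module. -/
/-- The standard scalar product of signature `(r,s)` on `ℝ^(r+s)`:
`⟨Z,W⟩_{r,s} = ∑_{i<r} Z i * W i - ∑_{r ≤ i < r+s} Z i * W i`. -/
def sform (r s : ℕ) (Z W : Fin (r + s) → ℝ) : ℝ :=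
  ∑ i : Fin (r + s), (if (i : ℕ) < r then (1 : ℝ) else -1) * Z i * W i

/-- `(V, B, J)` is an admissible module of the Clifford algebra `Cl_{r,s}`:
`V` is a nonzero finite-dimensional real vector space, `B` a nondegenerate
symmetric bilinear form on `V`, and `J : ℝ^{r+s} → End V` linear with
`J_Z ∘ J_Z = -⟨Z,Z⟩_{r,s} • id` and each `J_Z` skew-adjoint w.r.t. `B`. -/
def IsAdmissible (r s : ℕ) (V : Type) [AddCommGroup V] [Module ℝ V]
    (B : V →ₗ[ℝ] V →ₗ[ℝ] ℝ)
    (J : (Fin (r + s) → ℝ) →ₗ[ℝ] V →ₗ[ℝ] V) : Prop :=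
  FiniteDimensional ℝ V ∧ Nontrivial V ∧
  (∀ v w : V, B v w = B w v) ∧
  (∀ v : V, (∀ w : V, B v w = 0) → v = 0) ∧
  (∀ (Z : Fin (r + s) → ℝ) (v : V), J Z (J Z v) = (-(sform r s Z Z)) • v) ∧
  (∀ (Z : Fin (r + s) → ℝ) (v w : V), B (J Z v) w = -(B v (J Z w)))

/-- A minimal admissible `Cl_{r,s}`-module: one of least possible dimension. -/
def IsMinimalAdmissible (r s : ℕ) (V : Type) [AddCommGroup V] [Module ℝ V]
    (B : V →ₗ[ℝ] V →ₗ[ℝ] ℝ)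
    (J : (Fin (r + s) → ℝ) →ₗ[ℝ] V →ₗ[ℝ] V) : Prop :=
  IsAdmissible r s V B J ∧
  ∀ (V' : Type) [AddCommGroup V'] [Module ℝ V']
    (B' : V' →ₗ[ℝ] V' →ₗ[ℝ] ℝ)
    (J' : (Fin (r + s) → ℝ) →ₗ[ℝ] V' →ₗ[ℝ] V'),
    IsAdmissible r s V' B' J' → Module.finrank ℝ V ≤ Module.finrank ℝ V'

/-- `br` is the Lie bracket of the pseudo `H`-type Lie algebra `V ⊕ ℝ^{r+s}`
determined by the admissible module `(V,B,J)`, i.e.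
`⟨Z, [v,w]⟩_{r,s} = ⟨J_Z v, w⟩_V` for all `Z, v, w`. -/
def IsHBracket (r s : ℕ) (V : Type) [AddCommGroup V] [Module ℝ V]
    (B : V →ₗ[ℝ] V →ₗ[ℝ] ℝ)
    (J : (Fin (r + s) → ℝ) →ₗ[ℝ] V →ₗ[ℝ] V)
    (br : V →ₗ[ℝ] V →ₗ[ℝ] (Fin (r + s) → ℝ)) : Prop :=
  ∀ (Z : Fin (r + s) → ℝ) (v w : V), sform r s Z (br v w) = B (J Z v) w

/-- A linear equivalence `f` between the pseudo `H`-type Lie algebras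
`V₁ ⊕ ℝ^{n₁}` and `V₂ ⊕ ℝ^{n₂}` (with 2-step brackets `br₁`, `br₂`, the
`ℝ^{nᵢ}` factors being central) is a Lie algebra isomorphism. -/
def IsLieIso {V₁ : Type} [AddCommGroup V₁] [Module ℝ V₁]
    {V₂ : Type} [AddCommGroup V₂] [Module ℝ V₂] {n₁ n₂ : ℕ}
    (br₁ : V₁ →ₗ[ℝ] V₁ →ₗ[ℝ] (Fin n₁ → ℝ))
    (br₂ : V₂ →ₗ[ℝ] V₂ →ₗ[ℝ] (Fin n₂ → ℝ))
    (f : (V₁ × (Fin n₁ → ℝ)) ≃ₗ[ℝ] (V₂ × (Fin n₂ → ℝ))) : Prop :=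
  ∀ x y : V₁ × (Fin n₁ → ℝ),
    f (0, br₁ x.1 y.1) = (0, br₂ (f x).1 (f y).1)


section Reduction

variable {V : Type*} [AddCommGroup V] [Module ℝ V]

/-- The fixed vectors of `T` lying in `U`. -/
def fixedIn (U : Submodule ℝ V) (T : Module.End ℝ V) : Submodule ℝ V :=
  U ⊓ LinearMap.ker (T - 1)

lemma mem_fixedIn {U : Submodule ℝ V} {T : Module.End ℝ V} {v : V} :
    v ∈ fixedIn U T ↔ v ∈ U ∧ T v = v := by
  simp [fixedIn, sub_eq_zero]

/-- An operator preserving `U` and commuting with `T` preserves the fixed vectors of `T` in `U`. -/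
lemma map_mem_fixedIn {U : Submodule ℝ V} {T x : Module.End ℝ V} (hU : ∀ v ∈ U, x v ∈ U)
    (hx : ∀ v, T (x v) = x (T v)) : ∀ v ∈ fixedIn U T, x v ∈ fixedIn U T := by
  intro v hv
  rw [mem_fixedIn] at hv ⊢
  exact ⟨hU v hv.1, by rw [hx, hv.2]⟩

lemma fixedIn_ne_bot {U : Submodule ℝ V} {T g : Module.End ℝ V} (hU : U ≠ ⊥)
    (hTU : ∀ v ∈ U, T v ∈ U) (hgU : ∀ v ∈ U, g v ∈ U) (hT : ∀ v, T (T v) = v)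
    (hTg : ∀ v, T (g v) = -g (T v)) (hg : ∀ v, g v = 0 → v = 0) : fixedIn U T ≠ ⊥ := by
  obtain ⟨u, hu, hu0⟩ := U.exists_mem_ne_zero_of_ne_bot hU
  rw [Submodule.ne_bot_iff]
  by_cases h : u + T u = 0
  · refine ⟨g u, mem_fixedIn.2 ⟨hgU u hu, ?_⟩, fun h0 => hu0 (hg u h0)⟩
    rw [hTg, eq_neg_of_add_eq_zero_right h, map_neg, neg_neg]
  · exact ⟨u + T u, mem_fixedIn.2 ⟨U.add_mem hu (hTU u hu), by rw [map_add, hT, add_comm]⟩, h⟩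

lemma eq_zero_of_sq_eq_neg {g : Module.End ℝ V} (hg : ∀ v, g (g v) = -v) :
    ∀ v, g v = 0 → v = 0 := fun v hv => by
  rw [← neg_eq_zero, ← hg v, hv, map_zero]

/-- A set of operators is reducible on `U` if it preserves some nonzero proper subspace of `U`. -/
def ReducibleOn (G : Set (Module.End ℝ V)) (U : Submodule ℝ V) : Prop :=
  ∃ W : Submodule ℝ V, W ≠ ⊥ ∧ W < U ∧ ∀ x ∈ G, ∀ w ∈ W, x w ∈ W

/-- Reducibility on the fixed vectors of an involution `T` induces up along an operator `g`
anticommuting with `T`. -/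
lemma ReducibleOn.induce {G H : Set (Module.End ℝ V)} {U : Submodule ℝ V}
    {T g : Module.End ℝ V} (hgU : ∀ v ∈ U, g v ∈ U)
    (hTg : ∀ v, T (g v) = -g (T v)) (hg : ∀ v, g (g v) = -v)
    (hxg : ∀ x ∈ G, (∀ v, x (g v) = g (x v)) ∨ (∀ v, x (g v) = -g (x v)))
    (hG : ∀ x ∈ G, ∀ W : Submodule ℝ V, (∀ y ∈ H, ∀ w ∈ W, y w ∈ W) → (∀ w ∈ W, T w = w) →
      (∀ w ∈ W, x w ∈ W) ∨ (∀ w ∈ W, g (x w) ∈ W))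
    (h : ReducibleOn H (fixedIn U T)) : ReducibleOn G U := by
  obtain ⟨W, hW0, hWlt, hWH⟩ := h
  have hWT : ∀ w ∈ W, T w = w := fun w hw => (mem_fixedIn.1 (hWlt.le hw)).2
  have hWU : W ≤ U := fun w hw => (mem_fixedIn.1 (hWlt.le hw)).1
  have hWl : ∀ w ∈ W, w ∈ W ⊔ W.map g := fun w hw => Submodule.mem_sup_left hw
  have hWr : ∀ w ∈ W, g w ∈ W ⊔ W.map g := fun w hw =>
    Submodule.mem_sup_right (Submodule.mem_map_of_mem hw)
  refine ⟨W ⊔ W.map g, fun h0 => hW0 (le_bot_iff.1 (h0 ▸ le_sup_left)), ?_, ?_⟩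
  · refine lt_of_le_of_ne (sup_le hWU (Submodule.map_le_iff_le_comap.2 fun w hw =>
      hgU w (hWU hw))) fun heq => hWlt.not_ge fun u hu => ?_
    rw [mem_fixedIn, ← heq, Submodule.mem_sup] at hu
    obtain ⟨⟨w, hw, _, ⟨w', hw', rfl⟩, rfl⟩, hT⟩ := hu
    rw [map_add, hTg, hWT w hw, hWT w' hw'] at hT
    have h2 : (2 : ℝ) • g w' = 0 := by
      have h1 : -g w' = g w' := add_left_cancel hT
      rw [two_smul]
      nth_rewrite 1 [← h1]
      exact neg_add_cancel _
    rw [(smul_eq_zero.1 h2).resolve_left two_ne_zero, add_zero]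
    exact hw
  · intro x hx v hv
    rw [Submodule.mem_sup] at hv
    obtain ⟨w, hw, _, ⟨w', hw', rfl⟩, rfl⟩ := hv
    rw [map_add]
    have key : ∀ w ∈ W, x w ∈ W ⊔ W.map g ∧ g (x w) ∈ W ⊔ W.map g := by
      intro w hw
      rcases hG x hx W hWH hWT with h | h
      · exact ⟨hWl _ (h w hw), hWr _ (h w hw)⟩
      · refine ⟨?_, hWl _ (h w hw)⟩
        have := hWr _ (h w hw)
        rwa [hg, neg_mem_iff] at this
    refine add_mem (key w hw).1 ?_
    rcases hxg x hx with h | h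
    · rw [h]; exact (key w' hw').2
    · rw [h]; exact neg_mem (key w' hw').2

/-- `a, b` and `c, d` generate two commuting quaternionic structures. -/
structure IsQuaternionPair (a b c d : Module.End ℝ V) : Prop where
  sq_a : ∀ v, a (a v) = -v
  sq_b : ∀ v, b (b v) = -v
  sq_c : ∀ v, c (c v) = -v
  sq_d : ∀ v, d (d v) = -v
  anti_ab : ∀ v, b (a v) = -a (b v)
  anti_cd : ∀ v, d (c v) = -c (d v)
  comm_ac : ∀ v, c (a v) = a (c v)
  comm_ad : ∀ v, d (a v) = a (d v)
  comm_bc : ∀ v, c (b v) = b (c v)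
  comm_bd : ∀ v, d (b v) = b (d v)

lemma IsQuaternionPair.fixedIn_ne_bot {U : Submodule ℝ V} {a b c d : Module.End ℝ V}
    (h : IsQuaternionPair a b c d) (hU : U ≠ ⊥)
    (haU : ∀ v ∈ U, a v ∈ U) (hbU : ∀ v ∈ U, b v ∈ U) (hcU : ∀ v ∈ U, c v ∈ U)
    (hdU : ∀ v ∈ U, d v ∈ U) : fixedIn (fixedIn U (a * c)) (b * d) ≠ ⊥ := by
  obtain ⟨ha, hb, hc, hd, hab, hcd, hac, had, hbc, hbd⟩ := h
  refine _root_.fixedIn_ne_bot (g := a) (_root_.fixedIn_ne_bot (g := b) hU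
    (fun v hv => haU _ (hcU v hv)) hbU (by simp [hac, ha, hc]) (by simp [hab, hbc])
    (eq_zero_of_sq_eq_neg hb)) (map_mem_fixedIn (fun v hv => hbU _ (hdU v hv)) ?_)
    (map_mem_fixedIn haU (by simp [hac])) ?_ ?_ (eq_zero_of_sq_eq_neg ha)
  · simp [hbc, hcd, hab, had]
  · simp [hb, hd, hbd]
  · simp [had, hab]

/-- Adding to `G` two quaternionic structures that commute with each other and with `G`. -/
lemma ReducibleOn.insert_quaternion_pair {G : Set (Module.End ℝ V)} {U : Submodule ℝ V}
    {a b c d : Module.End ℝ V} (hq : IsQuaternionPair a b c d)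
    (hGa : ∀ x ∈ G, ∀ v, x (a v) = a (x v)) (hGb : ∀ x ∈ G, ∀ v, x (b v) = b (x v))
    (haU : ∀ v ∈ U, a v ∈ U) (hbU : ∀ v ∈ U, b v ∈ U)
    (h : ReducibleOn G (fixedIn (fixedIn U (a * c)) (b * d))) :
    ReducibleOn (G ∪ {a, b, c, d}) U := by
  obtain ⟨ha, hb, hc, hd, hab, hcd, hac, had, hbc, hbd⟩ := hq
  refine ReducibleOn.induce (T := a * c) (g := b) (H := G ∪ {a, b * d}) hbU ?_ hb ?_ ?_ ?_
  · simp [hab, hbc]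
  · rintro x (hx | rfl | rfl | rfl | rfl)
    · exact .inl (hGb x hx)
    · exact .inr (by simp [hab])
    · exact .inl (by simp)
    · exact .inl hbc
    · exact .inl hbd
  · rintro x (hx | rfl | rfl | rfl | rfl) W hW hT
    · exact .inl (hW x (.inl hx))
    · exact .inl (hW x (by simp))
    · exact .inr (by simp [hb])
    · left
      intro w hw
      have := hW a (by simp) w hw
      rw [← hT w hw]
      simpa [hac, hc] using this
    · exact .inr (hW (b * x) (by simp))
  · refine ReducibleOn.induce (T := b * d) (g := a) (H := G) ?_ ?_ ha ?_ ?_ h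
    · exact map_mem_fixedIn haU (by simp [hac])
    · simp [had, hab]
    · rintro x (hx | rfl | rfl)
      · exact .inl (hGa x hx)
      · exact .inl (by simp)
      · exact .inr (by simp [had, hab])
    · rintro x (hx | rfl | rfl) W hW hT
      · exact .inl (hW x hx)
      · exact .inr (by simp [ha])
      · exact .inl fun w hw => by rwa [hT w hw]

lemma ReducibleOn.mono {G H : Set (Module.End ℝ V)} {U : Submodule ℝ V} (hGH : G ⊆ H)
    (h : ReducibleOn H U) : ReducibleOn G U := by
  obtain ⟨W, h0, hlt, hW⟩ := h
  exact ⟨W, h0, hlt, fun x hx => hW x (hGH hx)⟩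

/-- `J 0, …, J (n - 1)` are pairwise anticommuting complex structures. -/
structure IsCliffordSystem (n : ℕ) (J : ℕ → Module.End ℝ V) : Prop where
  sq : ∀ {i : ℕ}, i < n → ∀ v, J i (J i v) = -v
  anti : ∀ {i j : ℕ}, j < i → i < n → ∀ v, J i (J j v) = -J j (J i v)

lemma IsCliffordSystem.shift {n m : ℕ} {J : ℕ → Module.End ℝ V}
    (hJ : IsCliffordSystem (n + m) J) : IsCliffordSystem n (fun i => J (i + m)) :=
  ⟨fun hi => hJ.sq (by omega), fun hj hi => hJ.anti (by omega) (by omega)⟩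

lemma IsCliffordSystem.of_le {n m : ℕ} {J : ℕ → Module.End ℝ V}
    (hJ : IsCliffordSystem n J) (h : m ≤ n) : IsCliffordSystem m J :=
  ⟨fun hi => hJ.sq (by omega), fun hj hi => hJ.anti (by omega) (by omega)⟩

/-- Removing four generators at the cost of a quaternionic structure. -/
lemma ReducibleOn.insert_four {G : Set (Module.End ℝ V)} {U : Submodule ℝ V}
    {K : ℕ → Module.End ℝ V} (hK : IsCliffordSystem 4 K)
    (hG : ∀ x ∈ G, (∀ v, x (K 0 v) = K 0 (x v)) ∨ (∀ v, x (K 0 v) = -K 0 (x v)))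
    (hU : ∀ v ∈ U, K 0 v ∈ U)
    (h : ReducibleOn (G ∪ {K 0 * K 1, K 0 * K 2}) (fixedIn U (K 0 * K 1 * K 2 * K 3))) :
    ReducibleOn (G ∪ {K 0, K 1, K 2, K 3}) U := by
  have sq := @hK.sq
  have anti := @hK.anti
  refine h.induce (g := K 0) hU ?_ (sq (by omega)) ?_ ?_
  · intro v
    simp (discharger := omega) [sq, anti]
  · rintro x (hx | rfl | rfl | rfl | rfl)
    · exact hG x hx
    · exact .inl (by simp)
    all_goals exact .inr (by simp (discharger := omega) [anti])
  · rintro x (hx | rfl | rfl | rfl | rfl) W hW hT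
    · exact .inl (hW x (.inl hx))
    · exact .inr (by simp (discharger := omega) [sq])
    · exact .inr (hW (K 0 * K 1) (by simp))
    · exact .inr (hW (K 0 * K 2) (by simp))
    · right
      intro w hw
      have h2 := hW (K 0 * K 1) (by simp) _ (hW (K 0 * K 2) (by simp) w hw)
      rw [← hT w hw]
      simp (discharger := omega) [sq, anti] at h2 ⊢
      exact h2

lemma fixedIn_ne_self {U : Submodule ℝ V} {T S : Module.End ℝ V} (hU : U ≠ ⊥)
    (hSU : ∀ v ∈ U, S v ∈ U) (hTS : ∀ v, T (S v) = -S (T v)) (hS : ∀ v, S v = 0 → v = 0) :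
    fixedIn U T ≠ U := by
  intro h
  obtain ⟨u, hu, hu0⟩ := U.exists_mem_ne_zero_of_ne_bot hU
  have h1 := (mem_fixedIn.1 (h.ge hu)).2
  have h2 := (mem_fixedIn.1 (h.ge (hSU u hu))).2
  have : IsAddTorsionFree V := .of_isTorsionFree ℝ V
  rw [hTS, h1, neg_eq_self] at h2
  exact hu0 (hS u h2)

/-- A central involution anticommuting with `S` splits `U`. -/
lemma ReducibleOn.of_central {G : Set (Module.End ℝ V)} {U : Submodule ℝ V}
    {T S : Module.End ℝ V} (hU : U ≠ ⊥) (hTU : ∀ v ∈ U, T v ∈ U) (hSU : ∀ v ∈ U, S v ∈ U)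
    (hGU : ∀ x ∈ G, ∀ v ∈ U, x v ∈ U) (hT : ∀ v, T (T v) = v) (hS : ∀ v, S (S v) = v)
    (hTS : ∀ v, T (S v) = -S (T v)) (hGT : ∀ x ∈ G, ∀ v, T (x v) = x (T v)) :
    ReducibleOn G U := by
  have hS0 : ∀ v, S v = 0 → v = 0 := fun v hv => by rw [← hS v, hv, map_zero]
  exact ⟨fixedIn U T, fixedIn_ne_bot hU hTU hSU hT hTS hS0,
    lt_of_le_of_ne inf_le_left (fixedIn_ne_self hU hSU hTS hS0),
    fun x hx => map_mem_fixedIn (hGU x hx) (hGT x hx)⟩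

/-- A space with a complex structure has a proper nonzero real subspace. -/
lemma ReducibleOn.of_complex {U : Submodule ℝ V} {X : Module.End ℝ V} (hU : U ≠ ⊥)
    (hXU : ∀ v ∈ U, X v ∈ U) (hX : ∀ v, X (X v) = -v) : ReducibleOn ∅ U := by
  obtain ⟨u, hu, hu0⟩ := U.exists_mem_ne_zero_of_ne_bot hU
  refine ⟨ℝ ∙ u, by simpa using hu0, lt_of_le_of_ne (by simpa using hu) fun h => ?_, by simp⟩
  obtain ⟨a, ha⟩ := Submodule.mem_span_singleton.1 (h.ge (hXU u hu))
  have h1 : (a * a + 1) • u = 0 := by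
    have := hX u
    rw [← ha, map_smul, ← ha, smul_smul] at this
    rw [add_smul, this, one_smul, neg_add_cancel]
  rcases smul_eq_zero.1 h1 with h2 | h2
  · nlinarith
  · exact hu0 h2

/-- A space with a quaternionic structure has a proper nonzero complex subspace. -/
lemma ReducibleOn.of_quaternionic {U : Submodule ℝ V} {X Y : Module.End ℝ V} (hU : U ≠ ⊥)
    (hXU : ∀ v ∈ U, X v ∈ U) (hYU : ∀ v ∈ U, Y v ∈ U) (hX : ∀ v, X (X v) = -v)
    (hY : ∀ v, Y (Y v) = -v) (hYX : ∀ v, Y (X v) = -X (Y v)) : ReducibleOn {X} U := by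
  obtain ⟨u, hu, hu0⟩ := U.exists_mem_ne_zero_of_ne_bot hU
  refine ⟨Submodule.span ℝ {u, X u}, fun h => hu0 ?_, lt_of_le_of_ne ?_ fun h => ?_, ?_⟩
  · rw [← Submodule.mem_bot ℝ, ← h]
    exact Submodule.subset_span (by simp)
  · rw [Submodule.span_le]
    rintro _ (rfl | rfl)
    exacts [hu, hXU _ hu]
  · obtain ⟨a, b, hab⟩ := Submodule.mem_span_pair.1 (h.ge (hYU u hu))
    have h1 : (a * a + b * b + 1) • u = 0 := by
      have := hY u
      rw [← hab, map_add, map_smul, map_smul, hYX, ← hab, map_add, map_smul, map_smul, hX] at this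
      rw [← sub_eq_zero, sub_neg_eq_add] at this
      rw [← this]
      module
    rcases smul_eq_zero.1 h1 with h2 | h2
    · nlinarith
    · exact hu0 h2
  · rintro _ rfl w hw
    obtain ⟨a, b, rfl⟩ := Submodule.mem_span_pair.1 hw
    refine Submodule.mem_span_pair.2 ⟨-b, a, ?_⟩
    rw [map_add, map_smul, map_smul, hX]
    module

section CliffordSystem

variable {J : ℕ → Module.End ℝ V} {S : Module.End ℝ V} {U : Submodule ℝ V}

lemma IsCliffordSystem.reducibleOn_three (hJ : IsCliffordSystem 3 J)
    (hS : ∀ v, S (S v) = v) (hSJ : ∀ i < 3, ∀ v, S (J i v) = -J i (S v)) (hU : U ≠ ⊥)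
    (hJU : ∀ i < 3, ∀ v ∈ U, J i v ∈ U) (hSU : ∀ v ∈ U, S v ∈ U) :
    ReducibleOn (J '' Set.Iio 3) U := by
  have sq := @hJ.sq
  have anti := @hJ.anti
  refine .of_central (T := J 0 * J 1 * J 2) (S := S) hU ?_ hSU ?_ ?_ hS ?_ ?_
  · intro v hv
    exact hJU _ (by omega) _ (hJU _ (by omega) _ (hJU _ (by omega) _ hv))
  · rintro _ ⟨i, hi, rfl⟩
    exact hJU i hi
  · simp (discharger := omega) [sq, anti]
  · simp (discharger := omega) [hSJ]
  · rintro _ ⟨i, hi, rfl⟩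
    obtain rfl | rfl | rfl : i = 0 ∨ i = 1 ∨ i = 2 := by have := Set.mem_Iio.1 hi; omega
    all_goals simp (discharger := omega) [sq, anti]

lemma IsCliffordSystem.reducibleOn_seven (hJ : IsCliffordSystem 7 J)
    (hS : ∀ v, S (S v) = v) (hSJ : ∀ i < 7, ∀ v, S (J i v) = -J i (S v)) (hU : U ≠ ⊥)
    (hJU : ∀ i < 7, ∀ v ∈ U, J i v ∈ U) (hSU : ∀ v ∈ U, S v ∈ U) :
    ReducibleOn (J '' Set.Iio 7) U := by
  have sq := @hJ.sq
  have anti := @hJ.anti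
  refine .of_central (T := J 0 * J 1 * J 2 * J 3 * J 4 * J 5 * J 6) (S := S) hU ?_ hSU ?_ ?_ hS ?_ ?_
  · intro v hv
    simp only [Module.End.mul_apply]
    iterate 7 refine hJU _ (by omega) _ ?_
    exact hv
  · rintro _ ⟨i, hi, rfl⟩
    exact hJU i hi
  · simp (discharger := omega) [sq, anti]
  · simp (discharger := omega) [hSJ]
  · rintro _ ⟨i, hi, rfl⟩
    obtain rfl | rfl | rfl | rfl | rfl | rfl | rfl :
      i = 0 ∨ i = 1 ∨ i = 2 ∨ i = 3 ∨ i = 4 ∨ i = 5 ∨ i = 6 := by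
        have := Set.mem_Iio.1 hi; omega
    all_goals simp (discharger := omega) [sq, anti]

lemma IsCliffordSystem.fixedIn_four_ne_bot (hJ : IsCliffordSystem 4 J) (hU : U ≠ ⊥)
    (hJU : ∀ i < 4, ∀ v ∈ U, J i v ∈ U) : fixedIn U (J 0 * J 1 * J 2 * J 3) ≠ ⊥ := by
  have sq := @hJ.sq
  have anti := @hJ.anti
  refine fixedIn_ne_bot (g := J 0) hU ?_ (hJU 0 (by omega)) ?_ ?_
    (eq_zero_of_sq_eq_neg (sq (by omega)))
  · intro v hv
    simp only [Module.End.mul_apply]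
    iterate 4 refine hJU _ (by omega) _ ?_
    exact hv
  · simp (discharger := omega) [sq, anti]
  · simp (discharger := omega) [sq, anti]

lemma IsCliffordSystem.reducibleOn_five (hJ : IsCliffordSystem 5 J)
    (hS : ∀ v, S (S v) = v) (hSJ : ∀ i < 5, ∀ v, S (J i v) = -J i (S v)) (hU : U ≠ ⊥)
    (hJU : ∀ i < 5, ∀ v ∈ U, J i v ∈ U) (hSU : ∀ v ∈ U, S v ∈ U) :
    ReducibleOn (J '' Set.Iio 5) U := by
  have sq := @hJ.sq
  have anti := @hJ.anti
  have hU1 := (hJ.of_le (by omega : 4 ≤ 5)).fixedIn_four_ne_bot hU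
    (fun i hi => hJU i (by omega))
  set U1 := fixedIn U (J 0 * J 1 * J 2 * J 3)
  have h01 : ∀ v ∈ U1, (J 0 * J 1) v ∈ U1 := map_mem_fixedIn
    (fun v hv => hJU _ (by omega) _ (hJU _ (by omega) _ hv))
    (by simp (discharger := omega) [sq, anti])
  have h02 : ∀ v ∈ U1, (J 0 * J 2) v ∈ U1 := map_mem_fixedIn
    (fun v hv => hJU _ (by omega) _ (hJU _ (by omega) _ hv))
    (by simp (discharger := omega) [sq, anti])
  have h4 : ∀ v ∈ U1, J 4 v ∈ U1 := map_mem_fixedIn (hJU 4 (by omega))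
    (by simp (discharger := omega) [anti])
  have hS1 : ∀ v ∈ U1, S v ∈ U1 := map_mem_fixedIn hSU
    (by simp (discharger := omega) [hSJ])
  have hU2 : fixedIn U1 (J 0 * J 1 * J 4) ≠ ⊥ :=
    fixedIn_ne_bot (g := J 0 * J 2) hU1 (fun v hv => h01 _ (h4 v hv)) h02
      (by simp (discharger := omega) [sq, anti]) (by simp (discharger := omega) [sq, anti])
      (eq_zero_of_sq_eq_neg (by simp (discharger := omega) [sq, anti]))
  refine ReducibleOn.mono ?_ (ReducibleOn.insert_four (G := {J 4}) (K := J)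
    (hJ.of_le (by omega)) ?_ (hJU 0 (by omega)) ?_)
  · rintro _ ⟨i, hi, rfl⟩
    obtain rfl | rfl | rfl | rfl | rfl : i = 0 ∨ i = 1 ∨ i = 2 ∨ i = 3 ∨ i = 4 := by
      have := Set.mem_Iio.1 hi; omega
    all_goals simp
  · rintro _ rfl
    exact .inr (anti (by omega) (by omega))
  refine ReducibleOn.induce (T := J 0 * J 1 * J 4) (g := J 0 * J 2) (H := {J 4}) h02 ?_ ?_ ?_ ?_ ?_
  · simp (discharger := omega) [sq, anti]
  · simp (discharger := omega) [sq, anti]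
  · rintro x (rfl | rfl | rfl)
    · exact .inl (by simp (discharger := omega) [anti])
    · exact .inr (by simp (discharger := omega) [sq, anti])
    · exact .inl (by simp)
  · rintro x (rfl | rfl | rfl) W hW hT
    · exact .inl (hW _ rfl)
    · left
      intro w hw
      have := hW _ rfl w hw
      rw [← hT w hw]
      simpa (discharger := omega) [sq, anti] using this
    · exact .inr (by simp (discharger := omega) [sq, anti])
  · refine ReducibleOn.of_quaternionic (Y := S * J 0 * J 2) hU2 ?_ ?_ (sq (by omega)) ?_ ?_
    · exact map_mem_fixedIn h4 (by simp (discharger := omega) [sq, anti])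
    · exact map_mem_fixedIn (fun v hv => hS1 _ (h02 v hv))
        (by simp (discharger := omega) [sq, anti, hSJ])
    · simp (discharger := omega) [sq, anti, hSJ, hS]
    · simp (discharger := omega) [anti, hSJ]

lemma IsCliffordSystem.reducibleOn_six (hJ : IsCliffordSystem 6 J)
    (hS : ∀ v, S (S v) = v) (hSJ : ∀ i < 6, ∀ v, S (J i v) = -J i (S v)) (hU : U ≠ ⊥)
    (hJU : ∀ i < 6, ∀ v ∈ U, J i v ∈ U) (hSU : ∀ v ∈ U, S v ∈ U) :
    ReducibleOn (J '' Set.Iio 6) U := by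
  have sq := @hJ.sq
  have anti := @hJ.anti
  have hU1 := (hJ.of_le (by omega : 4 ≤ 6)).fixedIn_four_ne_bot hU
    (fun i hi => hJU i (by omega))
  set U1 := fixedIn U (J 0 * J 1 * J 2 * J 3)
  have h01 : ∀ v ∈ U1, (J 0 * J 1) v ∈ U1 := map_mem_fixedIn
    (fun v hv => hJU _ (by omega) _ (hJU _ (by omega) _ hv))
    (by simp (discharger := omega) [sq, anti])
  have h02 : ∀ v ∈ U1, (J 0 * J 2) v ∈ U1 := map_mem_fixedIn
    (fun v hv => hJU _ (by omega) _ (hJU _ (by omega) _ hv))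
    (by simp (discharger := omega) [sq, anti])
  have h4 : ∀ v ∈ U1, J 4 v ∈ U1 := map_mem_fixedIn (hJU 4 (by omega))
    (by simp (discharger := omega) [anti])
  have h5 : ∀ v ∈ U1, J 5 v ∈ U1 := map_mem_fixedIn (hJU 5 (by omega))
    (by simp (discharger := omega) [anti])
  refine ReducibleOn.mono ?_ (ReducibleOn.insert_four (G := {J 4, J 5}) (K := J)
    (hJ.of_le (by omega)) ?_ (hJU 0 (by omega)) ?_)
  · rintro _ ⟨i, hi, rfl⟩
    obtain rfl | rfl | rfl | rfl | rfl | rfl : i = 0 ∨ i = 1 ∨ i = 2 ∨ i = 3 ∨ i = 4 ∨ i = 5 := by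
      have := Set.mem_Iio.1 hi; omega
    all_goals simp
  · rintro _ (rfl | rfl)
    all_goals exact .inr (anti (by omega) (by omega))
  have hX : ∀ v, (S * J 0 * J 1 * J 2 * J 3 * J 4 * J 5) ((S * J 0 * J 1 * J 2 * J 3 * J 4 * J 5) v) = -v := by
    simp (discharger := omega) [sq, anti, hSJ, hS]
  have hXU : ∀ v ∈ U, (S * J 0 * J 1 * J 2 * J 3 * J 4 * J 5) v ∈ U := by
    intro v hv
    simp only [Module.End.mul_apply]
    refine hSU _ ?_
    iterate 6 refine hJU _ (by omega) _ ?_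
    exact hv
  have hq : IsQuaternionPair (J 0 * J 1) (J 0 * J 2) (J 4) (J 5) := by
    constructor <;> simp (discharger := omega) [sq, anti]
  refine (ReducibleOn.insert_quaternion_pair (G := ∅) hq (by simp) (by simp) h01 h02
    (.of_complex (hq.fixedIn_ne_bot hU1 h01 h02 h4 h5)
      (map_mem_fixedIn (map_mem_fixedIn (map_mem_fixedIn hXU ?_) ?_) ?_) hX)).mono ?_
  · simp (discharger := omega) [sq, anti, hSJ]
  · simp (discharger := omega) [sq, anti, hSJ]
  · simp (discharger := omega) [sq, anti, hSJ]
  · rintro x ((rfl | rfl) | (rfl | rfl)) <;> simp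

/-- Reduction of `n + 8` generators to `n` generators. -/
lemma IsCliffordSystem.reducibleOn_add_eight {n : ℕ} (hJ : IsCliffordSystem (n + 8) J)
    (hSJ : ∀ i < n + 8, ∀ v, S (J i v) = -J i (S v)) (hU : U ≠ ⊥)
    (hJU : ∀ i < n + 8, ∀ v ∈ U, J i v ∈ U) (hSU : ∀ v ∈ U, S v ∈ U)
    (ih : ∀ U' : Submodule ℝ V, U' ≠ ⊥ → (∀ i < n, ∀ v ∈ U', J (i + 8) v ∈ U') →
      (∀ v ∈ U', S v ∈ U') → ReducibleOn ((fun i => J (i + 8)) '' Set.Iio n) U') :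
    ReducibleOn (J '' Set.Iio (n + 8)) U := by
  have sq := @hJ.sq
  have anti := @hJ.anti
  have hq : IsQuaternionPair (J 0 * J 1) (J 0 * J 2) (J 4 * J 5) (J 4 * J 6) := by
    constructor <;> simp (discharger := omega) [sq, anti]
  have pair : ∀ i j, i < n + 8 → j < n + 8 → ∀ v ∈ U, (J i * J j) v ∈ U :=
    fun i j hi hj v hv => hJU _ hi _ (hJU _ hj _ hv)
  set U1 := fixedIn U (J 0 * J 1 * J 2 * J 3)
  have hU1 : U1 ≠ ⊥ := (hJ.of_le (by omega : 4 ≤ n + 8)).fixedIn_four_ne_bot hU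
    (fun i hi => hJU i (by omega))
  have hJ1 : ∀ i < n + 4, ∀ v ∈ U1, J (i + 4) v ∈ U1 := fun i hi =>
    map_mem_fixedIn (hJU _ (by omega)) (by simp (discharger := omega) [anti])
  have hS1 : ∀ v ∈ U1, S v ∈ U1 := map_mem_fixedIn hSU (by simp (discharger := omega) [hSJ])
  have ha1 : ∀ v ∈ U1, (J 0 * J 1) v ∈ U1 := map_mem_fixedIn (pair _ _ (by omega) (by omega))
    (by simp (discharger := omega) [sq, anti])
  have hb1 : ∀ v ∈ U1, (J 0 * J 2) v ∈ U1 := map_mem_fixedIn (pair _ _ (by omega) (by omega))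
    (by simp (discharger := omega) [sq, anti])
  set U2 := fixedIn U1 (J 4 * J 5 * J 6 * J 7)
  have hU2 : U2 ≠ ⊥ := ((hJ.shift (n := n + 4) (m := 4)).of_le
    (by omega : 4 ≤ n + 4)).fixedIn_four_ne_bot hU1 (fun i hi => hJ1 i (by omega))
  have hJ2 : ∀ i < n, ∀ v ∈ U2, J (i + 8) v ∈ U2 := fun i hi =>
    map_mem_fixedIn (hJ1 (i + 4) (by omega)) (by simp (discharger := omega) [anti])
  have hS2 : ∀ v ∈ U2, S v ∈ U2 := map_mem_fixedIn hS1 (by simp (discharger := omega) [hSJ])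
  have ha2 : ∀ v ∈ U2, (J 0 * J 1) v ∈ U2 := map_mem_fixedIn ha1
    (by simp (discharger := omega) [anti])
  have hb2 : ∀ v ∈ U2, (J 0 * J 2) v ∈ U2 := map_mem_fixedIn hb1
    (by simp (discharger := omega) [anti])
  have hc2 : ∀ v ∈ U2, (J 4 * J 5) v ∈ U2 := map_mem_fixedIn
    (fun v hv => hJ1 0 (by omega) _ (hJ1 1 (by omega) _ hv))
    (by simp (discharger := omega) [sq, anti])
  have hd2 : ∀ v ∈ U2, (J 4 * J 6) v ∈ U2 := map_mem_fixedIn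
    (fun v hv => hJ1 0 (by omega) _ (hJ1 2 (by omega) _ hv))
    (by simp (discharger := omega) [sq, anti])
  refine (ReducibleOn.insert_four (G := (fun i => J (i + 4)) '' Set.Iio (n + 4))
    (hJ.of_le (by omega)) ?_ (hJU 0 (by omega)) ?_).mono ?_
  · rintro _ ⟨i, hi, rfl⟩
    exact .inr (anti (by omega) (by have := Set.mem_Iio.1 hi; omega))
  · refine (ReducibleOn.insert_four (K := fun i => J (i + 4))
      (G := (fun i => J (i + 8)) '' Set.Iio n ∪ {J 0 * J 1, J 0 * J 2})
      ((hJ.shift (n := n + 4) (m := 4)).of_le (by omega)) ?_ (hJ1 0 (by omega)) ?_).mono ?_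
    · rintro _ (⟨i, hi, rfl⟩ | rfl | rfl)
      · exact .inr (anti (by omega) (by have := Set.mem_Iio.1 hi; omega))
      · exact .inl (by simp (discharger := omega) [anti])
      · exact .inl (by simp (discharger := omega) [anti])
    · refine (ReducibleOn.insert_quaternion_pair (G := (fun i => J (i + 8)) '' Set.Iio n)
        (U := U2) hq ?_ ?_ ha2 hb2
        (ih _ (hq.fixedIn_ne_bot hU2 ha2 hb2 hc2 hd2) (fun i hi => ?_) ?_)).mono ?_
      · rintro _ ⟨i, hi, rfl⟩
        have := Set.mem_Iio.1 hi
        simp (discharger := omega) [anti]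
      · rintro _ ⟨i, hi, rfl⟩
        have := Set.mem_Iio.1 hi
        simp (discharger := omega) [anti]
      · exact map_mem_fixedIn (map_mem_fixedIn (hJ2 i hi)
          (by simp (discharger := omega) [anti])) (by simp (discharger := omega) [anti])
      · exact map_mem_fixedIn (map_mem_fixedIn hS2
          (by simp (discharger := omega) [hSJ])) (by simp (discharger := omega) [hSJ])
      · rintro x ((hx | rfl | rfl) | (rfl | rfl))
        · exact .inl hx
        all_goals simp
    · rintro x (⟨i, hi, rfl⟩ | hx)
      · rcases lt_or_ge i 4 with h | h
        · right
          obtain rfl | rfl | rfl | rfl : i = 0 ∨ i = 1 ∨ i = 2 ∨ i = 3 := by omega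
          all_goals simp
        · obtain ⟨i, rfl⟩ := Nat.exists_eq_add_of_le' h
          exact .inl (.inl ⟨i, by simpa using hi, rfl⟩)
      · exact .inl (.inr hx)
  · rintro _ ⟨i, hi, rfl⟩
    rcases lt_or_ge i 4 with h | h
    · right
      obtain rfl | rfl | rfl | rfl : i = 0 ∨ i = 1 ∨ i = 2 ∨ i = 3 := by omega
      all_goals simp
    · obtain ⟨i, rfl⟩ := Nat.exists_eq_add_of_le' h
      exact .inl ⟨i, by have := Set.mem_Iio.1 hi; simp only [Set.mem_Iio]; omega, rfl⟩

theorem IsCliffordSystem.reducibleOn {r : ℕ} (hr : r = 3 ∨ r = 5 ∨ r = 6 ∨ r = 7) (t : ℕ)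
    (hJ : IsCliffordSystem (r + 8 * t) J)
    (hS : ∀ v, S (S v) = v) (hSJ : ∀ i < r + 8 * t, ∀ v, S (J i v) = -J i (S v)) (hU : U ≠ ⊥)
    (hJU : ∀ i < r + 8 * t, ∀ v ∈ U, J i v ∈ U) (hSU : ∀ v ∈ U, S v ∈ U) :
    ReducibleOn (J '' Set.Iio (r + 8 * t)) U := by
  induction t generalizing J U with
  | zero =>
    rcases hr with rfl | rfl | rfl | rfl
    · exact hJ.reducibleOn_three hS hSJ hU hJU hSU
    · exact hJ.reducibleOn_five hS hSJ hU hJU hSU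
    · exact hJ.reducibleOn_six hS hSJ hU hJU hSU
    · exact hJ.reducibleOn_seven hS hSJ hU hJU hSU
  | succ t ih =>
    refine IsCliffordSystem.reducibleOn_add_eight (n := r + 8 * t) hJ hSJ hU hJU hSU
      fun U' hU' hJU' hSU' => ih (J := fun i => J (i + 8)) (hJ.shift (m := 8))
        (fun i hi => hSJ (i + 8) (by omega)) hU' hJU' hSU'

end CliffordSystem

end Reduction

section InvariantForm

variable {V : Type*} [AddCommGroup V] [Module ℝ V]

/-- A symmetric positive definite bilinear form. -/
structure IsInnerForm (h : V →ₗ[ℝ] V →ₗ[ℝ] ℝ) : Prop where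
  symm : ∀ v w, h v w = h w v
  pos : ∀ v, v ≠ 0 → 0 < h v v

lemma exists_isInnerForm [FiniteDimensional ℝ V] :
    ∃ h : V →ₗ[ℝ] V →ₗ[ℝ] ℝ, IsInnerForm h := by
  let e := (Module.finBasis ℝ V).equivFun
  refine ⟨LinearMap.mk₂ ℝ (fun v w => e v ⬝ᵥ e w) (by simp) (by simp) (by simp) (by simp), ?_, ?_⟩
  · intro v w
    exact dotProduct_comm (e v) (e w)
  · intro v hv
    have h0 : e v ≠ 0 := by simpa using hv
    have h1 : 0 ≤ e v ⬝ᵥ e v := Finset.sum_nonneg fun i _ => mul_self_nonneg _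
    exact lt_of_le_of_ne h1 (fun h => h0 (dotProduct_self_eq_zero.1 h.symm))

/-- Pairwise anticommuting involutions preserve some inner product. -/
lemma exists_invariant_isInnerForm [FiniteDimensional ℝ V] (P : ℕ → Module.End ℝ V) (n : ℕ)
    (sq : ∀ i < n, ∀ v, P i (P i v) = v)
    (anti : ∀ i < n, ∀ j < n, i ≠ j → ∀ v, P i (P j v) = -P j (P i v)) :
    ∃ h : V →ₗ[ℝ] V →ₗ[ℝ] ℝ, IsInnerForm h ∧ ∀ i < n, ∀ v w, h (P i v) (P i w) = h v w := by
  induction n with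
  | zero =>
    obtain ⟨h, hh⟩ := exists_isInnerForm (V := V)
    exact ⟨h, hh, by simp⟩
  | succ n ih =>
    obtain ⟨h, hh, hP⟩ := ih (fun i hi => sq i (by omega))
      (fun i hi j hj => anti i (by omega) j (by omega))
    refine ⟨h + h.compl₁₂ (P n) (P n), ⟨fun v w => ?_, fun v hv => ?_⟩, fun i hi v w => ?_⟩
    · simp [hh.symm v w, hh.symm (P n v) (P n w)]
    · have h1 := hh.pos v hv
      have h2 : P n v ≠ 0 := fun h0 => hv (by rw [← sq n (by omega) v, h0, map_zero])
      simpa using add_pos h1 (hh.pos _ h2)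
    · rcases eq_or_ne i n with rfl | hin
      · simp [sq i hi, add_comm]
      · have hi' : i < n := by omega
        simp [anti n (by omega) i hi hin.symm, hP i hi']

lemma exists_eigenvector_of_symmetric [FiniteDimensional ℝ V] [Nontrivial V]
    {h : V →ₗ[ℝ] V →ₗ[ℝ] ℝ} (hh : IsInnerForm h) {A : Module.End ℝ V}
    (hA : ∀ v w, h (A v) w = h v (A w)) : ∃ (μ : ℝ) (x : V), x ≠ 0 ∧ A x = μ • x := by
  let core : InnerProductSpace.Core ℝ V :=
    { inner := fun v w => h v w
      conj_inner_symm := fun v w => hh.symm _ _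
      re_inner_nonneg := fun v => by
        rcases eq_or_ne v 0 with rfl | hv
        · simp
        · exact (hh.pos v hv).le
      add_left := fun u v w => by simp
      smul_left := fun v w r => by simp
      definite := fun v hv => by
        by_contra h0
        exact (hh.pos v h0).ne' hv }
  let : NormedAddCommGroup V := core.toNormedAddCommGroup
  let : InnerProductSpace ℝ V := InnerProductSpace.ofCore core.toCore
  have hsymm : A.IsSymmetric := hA
  obtain ⟨x, hx⟩ := hsymm.hasEigenvalue_iSup_of_finiteDimensional.exists_hasEigenvector
  exact ⟨_, x, hx.2, hx.apply_eq_smul⟩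

lemma IsInnerForm.nondegenerate {h : V →ₗ[ℝ] V →ₗ[ℝ] ℝ} (hh : IsInnerForm h) :
    LinearMap.BilinForm.Nondegenerate h := by
  constructor
  · intro v hv
    by_contra h0
    exact (hh.pos v h0).ne' (hv v)
  · intro v hv
    by_contra h0
    exact (hh.pos v h0).ne' (hv v)

end InvariantForm

lemma sform_zero_left (n : ℕ) (Z W : Fin (0 + n) → ℝ) : sform 0 n Z W = -(Z ⬝ᵥ W) := by
  simp [sform, dotProduct]

lemma sform_zero_right (n : ℕ) (Z W : Fin (n + 0) → ℝ) : sform n 0 Z W = Z ⬝ᵥ W := by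
  refine Finset.sum_congr rfl fun i _ => ?_
  rw [if_pos (by omega), one_mul]

/-- The standard basis vectors of `ℝ^n`, indexed by all natural numbers. -/
def stdVec (n i : ℕ) : Fin n → ℝ := fun k => if (k : ℕ) = i then 1 else 0

lemma eq_sum_stdVec {n : ℕ} (Z : Fin n → ℝ) : Z = ∑ k, Z k • stdVec n k := by
  funext j
  simp [stdVec, Fin.val_inj]

lemma stdVec_dotProduct_stdVec {n i : ℕ} (hi : i < n) (j : ℕ) :
    stdVec n i ⬝ᵥ stdVec n j = if i = j then 1 else 0 := by
  rw [dotProduct, Finset.sum_eq_single ⟨i, hi⟩]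
  · simp [stdVec]
  · intro b _ hb
    have : (b : ℕ) ≠ i := fun h => hb (Fin.ext h)
    simp [stdVec, this]
  · simp

section Admissible

variable {n : ℕ} {V : Type} [AddCommGroup V] [Module ℝ V]
  {B : V →ₗ[ℝ] V →ₗ[ℝ] ℝ} {J : (Fin (0 + n) → ℝ) →ₗ[ℝ] V →ₗ[ℝ] V}

lemma IsAdmissible.sq_apply (hV : IsAdmissible 0 n V B J) (Z : Fin (0 + n) → ℝ) (v : V) :
    J Z (J Z v) = (Z ⬝ᵥ Z) • v := by
  rw [hV.2.2.2.2.1, sform_zero_left, neg_neg]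

lemma IsAdmissible.polarization (hV : IsAdmissible 0 n V B J) (Z W : Fin (0 + n) → ℝ) (v : V) :
    J Z (J W v) + J W (J Z v) = (2 * (Z ⬝ᵥ W)) • v := by
  have h := hV.sq_apply (Z + W) v
  simp only [map_add, LinearMap.add_apply, hV.sq_apply, add_dotProduct, dotProduct_add] at h
  rw [dotProduct_comm W Z] at h
  have h' : J Z (J W v) + J W (J Z v) =
      (Z ⬝ᵥ Z + Z ⬝ᵥ W + (Z ⬝ᵥ W + W ⬝ᵥ W)) • v - (Z ⬝ᵥ Z) • v - (W ⬝ᵥ W) • v := by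
    rw [← h]
    abel
  rw [h']
  module

lemma IsAdmissible.stdVec_sq (hV : IsAdmissible 0 n V B J) {i : ℕ} (hi : i < n) (v : V) :
    J (stdVec (0 + n) i) (J (stdVec (0 + n) i) v) = v := by
  rw [hV.sq_apply, stdVec_dotProduct_stdVec (by omega), if_pos rfl, one_smul]

lemma IsAdmissible.stdVec_anti (hV : IsAdmissible 0 n V B J) {i j : ℕ} (hi : i < n)
    (hij : i ≠ j) (v : V) : J (stdVec (0 + n) i) (J (stdVec (0 + n) j) v) =
      -J (stdVec (0 + n) j) (J (stdVec (0 + n) i) v) := by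
  have h := hV.polarization (stdVec (0 + n) i) (stdVec (0 + n) j) v
  rw [stdVec_dotProduct_stdVec (by omega), if_neg hij, mul_zero, zero_smul] at h
  exact eq_neg_of_add_eq_zero_left h

/-- An admissible `Cl_{0,n}`-module carries an inner product for which the Clifford action is
self-adjoint, and the admissible form is given by a self-adjoint operator `A` which anticommutes
with the action. -/
lemma IsAdmissible.exists_innerForm (hV : IsAdmissible 0 n V B J) :
    ∃ (h : V →ₗ[ℝ] V →ₗ[ℝ] ℝ) (A : Module.End ℝ V), IsInnerForm h ∧
      (∀ v w, h (A v) w = h v (A w)) ∧ (∀ v, A v = 0 → v = 0) ∧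
      (∀ Z v w, h (J Z v) w = h v (J Z w)) ∧ ∀ Z v, A (J Z v) = -J Z (A v) := by
  have := hV.1
  obtain ⟨h, hh, hP⟩ := exists_invariant_isInnerForm (fun i => J (stdVec (0 + n) i)) n
    (fun i hi => hV.stdVec_sq hi) (fun i hi j _ hij => hV.stdVec_anti hi hij)
  have hJ : ∀ Z v w, h (J Z v) w = h v (J Z w) := by
    intro Z v w
    rw [eq_sum_stdVec Z]
    simp only [map_sum, LinearMap.sum_apply, map_smul, LinearMap.smul_apply]
    refine Finset.sum_congr rfl fun k _ => ?_
    have hk : (k : ℕ) < n := by omega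
    rw [← hP k hk, hV.stdVec_sq hk]
  obtain ⟨-, -, hBs, hB0, -, hBJ⟩ := hV
  let A : Module.End ℝ V := LinearMap.BilinForm.symmCompOfNondegenerate B h hh.nondegenerate
  have hA : ∀ v w, h (A v) w = B v w := fun v w =>
    LinearMap.BilinForm.symmCompOfNondegenerate_left_apply B hh.nondegenerate w v
  refine ⟨h, A, hh, fun v w => ?_, fun v hv => hB0 v fun w => ?_, hJ, fun Z v => ?_⟩
  · rw [hA, hh.symm, hA, hBs]
  · rw [← hA, hv, map_zero, LinearMap.zero_apply]
  · have key : ∀ w, h (A (J Z v) + J Z (A v)) w = 0 := fun w => by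
      rw [map_add, LinearMap.add_apply, hA, hJ, hA, hBJ, neg_add_cancel]
    by_contra h0
    exact (hh.pos _ fun h1 => h0 (eq_neg_of_add_eq_zero_left h1)).ne' (key _)

/-- A subspace invariant under the operators `A ∘ J_Z` with `A² = μ²` is an admissible
`Cl_{n,0}`-module. -/
lemma exists_isAdmissible_of_invariant [FiniteDimensional ℝ V] {h : V →ₗ[ℝ] V →ₗ[ℝ] ℝ}
    {A : Module.End ℝ V} (hh : IsInnerForm h) (hAs : ∀ v w, h (A v) w = h v (A w))
    (hJs : ∀ Z v w, h (J Z v) w = h v (J Z w)) (hAJ : ∀ Z v, A (J Z v) = -J Z (A v))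
    (hJ : ∀ Z v, J Z (J Z v) = (Z ⬝ᵥ Z) • v) {μ : ℝ} (hμ : μ ≠ 0) {W : Submodule ℝ V}
    (hW : W ≠ ⊥) (hAW : ∀ w ∈ W, A (A w) = (μ * μ) • w) (hJW : ∀ Z, ∀ w ∈ W, A (J Z w) ∈ W) :
    ∃ B' J', IsAdmissible n 0 W B' J' := by
  let c : (Fin (n + 0) → ℝ) →ₗ[ℝ] (Fin (0 + n) → ℝ) :=
    LinearMap.funLeft ℝ ℝ (finCongr (by omega : 0 + n = n + 0))
  have hc : ∀ Z, c Z ⬝ᵥ c Z = Z ⬝ᵥ Z := fun Z =>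
    (finCongr (by omega : 0 + n = n + 0)).sum_comp (fun i => Z i * Z i)
  let J' : (Fin (n + 0) → ℝ) →ₗ[ℝ] W →ₗ[ℝ] W :=
    LinearMap.mk₂ ℝ (fun Z w => ⟨μ⁻¹ • A (J (c Z) w), W.smul_mem _ (hJW _ _ w.2)⟩)
      (fun _ _ _ => Subtype.ext (by simp)) (fun _ _ _ => Subtype.ext (by simp [smul_comm μ⁻¹]))
      (fun _ _ _ => Subtype.ext (by simp)) (fun _ _ _ => Subtype.ext (by simp [smul_comm μ⁻¹]))
  refine ⟨h.compl₁₂ W.subtype W.subtype, J', inferInstance,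
    Submodule.nontrivial_iff_ne_bot.2 hW, fun v w => hh.symm _ _, fun v hv => ?_,
    fun Z v => Subtype.ext ?_, fun Z v w => ?_⟩
  · by_contra h0
    exact (hh.pos v (by simpa using h0)).ne' (hv v)
  · rw [sform_zero_right, ← hc]
    simp [J', hAJ, hJ, hAW _ v.2, smul_smul, ← mul_assoc, mul_comm, mul_inv_cancel₀ hμ]
  · simp [J', hAs, hJs, hAJ]

/-- The restriction of a Clifford action and of an operator anticommuting with it yields a
subspace invariant under the products. -/
lemma IsAdmissible.exists_invariant {r t : ℕ} (hr : r = 3 ∨ r = 5 ∨ r = 6 ∨ r = 7)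
    {J : (Fin (0 + (r + 8 * t)) → ℝ) →ₗ[ℝ] V →ₗ[ℝ] V}
    (hV : IsAdmissible 0 (r + 8 * t) V B J) {A : Module.End ℝ V}
    (hAJ : ∀ Z v, A (J Z v) = -J Z (A v)) {μ : ℝ} (hμ : μ ≠ 0) {x : V} (hx0 : x ≠ 0)
    (hx : A x = μ • x) :
    ∃ W : Submodule ℝ V, W ≠ ⊥ ∧ W ≠ ⊤ ∧ (∀ w ∈ W, A (A w) = (μ * μ) • w) ∧
      ∀ Z, ∀ w ∈ W, A (J Z w) ∈ W := by
  let U : Submodule ℝ V := LinearMap.ker (A * A - (μ * μ) • 1)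
  have hU : ∀ {v}, v ∈ U ↔ A (A v) = (μ * μ) • v := by simp [U, sub_eq_zero]
  have hAU : ∀ v ∈ U, A v ∈ U := fun v hv => by
    rw [hU] at hv ⊢
    rw [hv, map_smul]
  have hJU : ∀ Z, ∀ v ∈ U, J Z v ∈ U := fun Z v hv => by
    rw [hU] at hv ⊢
    rw [hAJ, map_neg, hAJ, neg_neg, hv, map_smul]
  have hxU : x ∈ U := hU.2 (by rw [hx, map_smul, hx, smul_smul])
  let S : Module.End ℝ U := μ⁻¹ • A.restrict hAU
  let P : ℕ → Module.End ℝ U := fun i => (J (stdVec _ i)).restrict (hJU _)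
  have hS : ∀ v, S (S v) = v := fun v => Subtype.ext <| by
    simp [S, hU.1 v.2, smul_smul, show μ⁻¹ * μ⁻¹ * (μ * μ) = 1 by field_simp]
  have hSP : ∀ i v, S (P i v) = -P i (S v) := fun i v => Subtype.ext <| by
    simp [S, P, hAJ]
  have hPP : ∀ i < r + 8 * t, ∀ v, P i (P i v) = v := fun i hi v => Subtype.ext <| by
    simp [P, hV.stdVec_sq hi]
  have hPQ : ∀ {i j}, j < i → i < r + 8 * t → ∀ v, P i (P j v) = -P j (P i v) :=
    fun hij hi v => Subtype.ext <| by simp [P, hV.stdVec_anti hi hij.ne']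
  have hsys : IsCliffordSystem (r + 8 * t) (fun i => S * P i) :=
    ⟨fun hi v => by simp [hSP, hS, hPP _ hi], fun hij hi v => by simp [hSP, hPQ hij hi]⟩
  have hUtop : (⊤ : Submodule ℝ U) ≠ ⊥ :=
    (Submodule.ne_bot_iff _).2 ⟨⟨x, hxU⟩, trivial, fun h => hx0 (congrArg Subtype.val h)⟩
  obtain ⟨W, hW0, hWlt, hW⟩ := hsys.reducibleOn (U := ⊤) hr t hS (fun i _ v => by simp [hSP])
    hUtop (by simp) (by simp)
  refine ⟨W.map U.subtype, ?_, fun h => hWlt.ne ?_, ?_, ?_⟩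
  · exact fun h => hW0 (Submodule.map_injective_of_injective U.injective_subtype
      (h.trans (Submodule.map_bot _).symm))
  · refine eq_top_iff.2 fun u _ => ?_
    obtain ⟨w, hw, hwu⟩ := Submodule.mem_map.1 (h ▸ Submodule.mem_top : (u : V) ∈ W.map U.subtype)
    rwa [← Subtype.ext hwu]
  · rintro _ ⟨w, -, rfl⟩
    exact hU.1 w.2
  · rintro Z _ ⟨w, hw, rfl⟩
    rw [eq_sum_stdVec Z]
    simp only [map_sum, LinearMap.sum_apply, map_smul, LinearMap.smul_apply]
    refine Submodule.sum_smul_mem _ _ fun k _ => ?_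
    refine ⟨μ • (S * P k) w, W.smul_mem _ (hW _ ⟨k, ?_, rfl⟩ w hw), ?_⟩
    · have := k.2
      simp only [Set.mem_Iio]
      omega
    · simp [S, P, smul_smul, hμ]

/-- Every admissible `Cl_{0,r+8t}`-module properly contains the underlying space of an admissible
`Cl_{r+8t,0}`-module. -/
theorem IsAdmissible.exists_isAdmissible_finrank_lt {r t : ℕ}
    (hr : r = 3 ∨ r = 5 ∨ r = 6 ∨ r = 7)
    {J : (Fin (0 + (r + 8 * t)) → ℝ) →ₗ[ℝ] V →ₗ[ℝ] V}
    (hV : IsAdmissible 0 (r + 8 * t) V B J) :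
    ∃ (W : Submodule ℝ V) (B' : W →ₗ[ℝ] W →ₗ[ℝ] ℝ)
      (J' : (Fin (r + 8 * t + 0) → ℝ) →ₗ[ℝ] W →ₗ[ℝ] W),
      IsAdmissible (r + 8 * t) 0 W B' J' ∧ Module.finrank ℝ W < Module.finrank ℝ V := by
  have := hV.1
  have := hV.2.1
  obtain ⟨h, A, hh, hAs, hA0, hJs, hAJ⟩ := hV.exists_innerForm
  obtain ⟨μ, x, hx0, hx⟩ := exists_eigenvector_of_symmetric hh hAs
  have hμ : μ ≠ 0 := by
    rintro rfl
    exact hx0 (hA0 x (by rw [hx, zero_smul]))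
  obtain ⟨W, hW0, hW1, hAW, hJW⟩ := hV.exists_invariant hr hAJ hμ hx0 hx
  obtain ⟨B', J', hadm⟩ :=
    exists_isAdmissible_of_invariant hh hAs hJs hAJ hV.sq_apply hμ hW0 hAW hJW
  exact ⟨W, B', J', hadm, Submodule.finrank_lt hW1⟩

end Admissible

theorem stmt7 (r : ℕ) (hr : r = 3 ∨ r = 5 ∨ r = 6 ∨ r = 7) (t : ℕ)
    (V1 : Type) [AddCommGroup V1] [Module ℝ V1]
    (B1 : V1 →ₗ[ℝ] V1 →ₗ[ℝ] ℝ)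
    (J1 : (Fin ((r + 8 * t) + 0) → ℝ) →ₗ[ℝ] V1 →ₗ[ℝ] V1)
    (br1 : V1 →ₗ[ℝ] V1 →ₗ[ℝ] (Fin ((r + 8 * t) + 0) → ℝ))
    (hadm1 : IsMinimalAdmissible (r + 8 * t) 0 V1 B1 J1)
    (hbr1 : IsHBracket (r + 8 * t) 0 V1 B1 J1 br1)
    (V2 : Type) [AddCommGroup V2] [Module ℝ V2]
    (B2 : V2 →ₗ[ℝ] V2 →ₗ[ℝ] ℝ)
    (J2 : (Fin (0 + (r + 8 * t)) → ℝ) →ₗ[ℝ] V2 →ₗ[ℝ] V2)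
    (br2 : V2 →ₗ[ℝ] V2 →ₗ[ℝ] (Fin (0 + (r + 8 * t)) → ℝ))
    (hadm2 : IsMinimalAdmissible 0 (r + 8 * t) V2 B2 J2)
    (hbr2 : IsHBracket 0 (r + 8 * t) V2 B2 J2 br2)
    :
    ¬ ∃ f : (V1 × (Fin ((r + 8 * t) + 0) → ℝ)) ≃ₗ[ℝ] (V2 × (Fin (0 + (r + 8 * t)) → ℝ)),
      IsLieIso br1 br2 f := by
  rintro ⟨f, -⟩
  obtain ⟨W, B', J', hW, hlt⟩ := hadm2.1.exists_isAdmissible_finrank_lt hr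
  have := hadm1.1.1
  have := hadm2.1.1
  have h1 := hadm1.2 W B' J' hW
  have h2 := f.finrank_eq
  simp only [Module.finrank_prod, Module.finrank_fin_fun] at h2
  omega
end

section
/- For every integer r ≥ 1, a pseudo H-type Lie algebra n_{r,8} built on a minimal admissible Cl_{r,8}-module is isomorphic as a Lie algebra to a pseudo H-type Lie algebra n_{8,r} built on a minimal admissible Cl_{8,r}-module if and only if r ≡ 0, 1, 2, or 4 (mod 8). -/
/-- The products of all sublists of a list. -/
def monomials {R : Type*} [Ring R] : List R → List R
  | [] => [1]
  | g :: gs => monomials gs ++ (monomials gs).map (· * g)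

/-- The sum of `(φ m)ᵀ * S * ψ m` over all monomials `m` in the list, defined recursively. -/
def twirl {n R : Type*} [Fintype n] [DecidableEq n] [Ring R] [Algebra ℝ R]
    (φ ψ : R →ₐ[ℝ] Matrix n n ℝ) : List R → Matrix n n ℝ → Matrix n n ℝ
  | [], S => S
  | g :: gs, S => twirl φ ψ gs S + (φ g).transpose * twirl φ ψ gs S * ψ g

/-- Lists built from at most one central element of square `-1` by successively adding
anticommuting pairs of square `±1` that commute with all earlier entries;
`Q` is the scalar by which the squares of the monomials sum up. -/
inductive PairList {R : Type*} [Ring R] [Algebra ℝ R] : List R → ℝ → Prop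
  | nil : PairList [] 1
  | central (z : R) (hz : z * z = -1) : PairList [z] 0
  | pair (gs : List R) (Q : ℝ) (a b : R) (α β : ℝ) (h : PairList gs Q)
      (ha : ∀ g ∈ gs, Commute a g) (hb : ∀ g ∈ gs, Commute b g)
      (hab : a * b = -(b * a)) (hα : α = 1 ∨ α = -1) (hβ : β = 1 ∨ β = -1)
      (haa : a * a = α • (1 : R)) (hbb : b * b = β • (1 : R)) :
      PairList (a :: b :: gs) (Q * (1 + α + β - α * β))

theorem commute_monomials {R : Type*} [Ring R] {gs : List R} {x : R} (hx : ∀ g ∈ gs, Commute x g) :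
    ∀ m ∈ monomials gs, Commute x m := by
  induction gs with
  | nil => simp [monomials]
  | cons g gs ih =>
    have ih' := ih fun y hy => hx y (by simp [hy])
    intro m hm
    simp only [monomials, List.mem_append, List.mem_map] at hm
    rcases hm with hm | ⟨m, hm, rfl⟩
    · exact ih' m hm
    · exact (ih' m hm).mul_right (hx g (by simp))

section Twirl

open Matrix

variable {n R : Type*} [Fintype n] [DecidableEq n] [Ring R] [Algebra ℝ R]
  (φ ψ : R →ₐ[ℝ] Matrix n n ℝ)

theorem twirl_invariant (S : Matrix n n ℝ) (gs : List R)
    (hsq : ∀ g ∈ gs, g * g = 1 ∨ g * g = -1)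
    (hc : ∀ g ∈ gs, ∀ h ∈ gs, g * h = h * g ∨ g * h = -(h * g)) :
    ∀ g ∈ gs, (φ g)ᵀ * twirl φ ψ gs S * ψ g = twirl φ ψ gs S := by
  induction gs with
  | nil => simp
  | cons g gs ih =>
    have ih' := ih (fun x hx => hsq x (by simp [hx]))
      (fun x hx y hy => hc x (by simp [hx]) y (by simp [hy]))
    set X := twirl φ ψ gs S with hX
    intro x hx
    have key : ∀ y : R, (φ y)ᵀ * ((φ g)ᵀ * X * ψ g) * ψ y
        = (φ (g * y))ᵀ * X * ψ (g * y) := by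
      intro y; simp only [map_mul, transpose_mul, Matrix.mul_assoc]
    simp only [twirl, ← hX, Matrix.mul_add, Matrix.add_mul, key]
    rcases List.mem_cons.1 hx with rfl | hx
    · rcases hsq x (by simp) with h | h <;> simp [h, add_comm]
    · have h2 : (φ (g * x))ᵀ * X * ψ (g * x) = (φ g)ᵀ * X * ψ g := by
        have h3 : (φ (x * g))ᵀ * X * ψ (x * g) = (φ g)ᵀ * X * ψ g := by
          conv_rhs => rw [← ih' x hx]
          simp only [map_mul, transpose_mul, Matrix.mul_assoc]
        rw [← h3]
        rcases hc g (by simp) x (by simp [hx]) with h | h <;> simp [h]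
      rw [ih' x hx, h2]

theorem twirl_eq_sum (S : Matrix n n ℝ) (gs : List R) :
    twirl φ ψ gs S = ((monomials gs).map fun m => (φ m)ᵀ * S * ψ m).sum := by
  induction gs with
  | nil => simp [twirl, monomials]
  | cons g gs ih =>
    rw [twirl, monomials, ih, List.map_append, List.sum_append, List.map_map,
      ← List.sum_map_mul_left, ← List.sum_map_mul_right]
    simp [Function.comp_def, Matrix.mul_assoc, Matrix.transpose_mul]

theorem twirl_posDef (gs : List R) {S : Matrix n n ℝ} (hS : S.PosDef) :
    (twirl φ φ gs S).PosDef := by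
  induction gs with
  | nil => exact hS
  | cons g gs ih =>
    rw [twirl]
    exact ih.add_posSemidef (by simpa using ih.posSemidef.conjTranspose_mul_mul_same (φ g))

theorem twirl_transpose (S : Matrix n n ℝ) (gs : List R) :
    (twirl φ φ gs S)ᵀ = twirl φ φ gs Sᵀ := by
  induction gs with
  | nil => rfl
  | cons g gs ih => simp [twirl, ih, Matrix.mul_assoc]

theorem trace_twirl (S : Matrix n n ℝ) (gs : List R)
    (ho : ∀ g ∈ gs, φ g * (φ g)ᵀ = 1) :
    (twirl φ φ gs S).trace = 2 ^ gs.length * S.trace := by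
  induction gs with
  | nil => simp [twirl]
  | cons g gs ih =>
    have h := ih fun x hx => ho x (by simp [hx])
    rw [twirl, trace_add, Matrix.mul_assoc, Matrix.trace_mul_comm, Matrix.mul_assoc,
      ho g (by simp), Matrix.mul_one, h, List.length_cons]
    ring

namespace PairList

variable {gs : List R} {Q : ℝ}

theorem mul_self_eq (h : PairList gs Q) : ∀ g ∈ gs, g * g = 1 ∨ g * g = -1 := by
  induction h with
  | nil => simp
  | central z hz => simp [hz]
  | pair gs Q a b α β h ha hb hab hα hβ haa hbb ih =>
    intro g hg
    simp only [List.mem_cons] at hg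
    rcases hg with rfl | rfl | hg
    · rcases hα with rfl | rfl <;> simp [haa]
    · rcases hβ with rfl | rfl <;> simp [hbb]
    · exact ih g hg

theorem commute_or_anticommute (h : PairList gs Q) :
    ∀ g ∈ gs, ∀ h ∈ gs, g * h = h * g ∨ g * h = -(h * g) := by
  induction h with
  | nil => simp
  | central z hz => simp
  | pair gs Q a b α β h ha hb hab hα hβ haa hbb ih =>
    intro g hg k hk
    simp only [List.mem_cons] at hg hk
    rcases hg with rfl | rfl | hg <;> rcases hk with rfl | rfl | hk
    · exact Or.inl rfl
    · exact Or.inr hab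
    · exact Or.inl (ha k hk)
    · right; rw [hab, neg_neg]
    · exact Or.inl rfl
    · exact Or.inl (hb k hk)
    · exact Or.inl (ha g hg).symm
    · exact Or.inl (hb g hg).symm
    · exact ih g hg k hk

theorem sum_mul_self (h : PairList gs Q) :
    ((monomials gs).map fun m => m * m).sum = Q • (1 : R) := by
  induction h with
  | nil => simp [monomials]
  | central z hz => simp [monomials, hz]
  | pair gs Q a b α β h ha hb hab hα hβ haa hbb ih =>
    have ca := commute_monomials ha
    have cb := commute_monomials hb
    have key : ∀ (x : R) (c : ℝ), x * x = c • (1 : R) → (∀ m ∈ monomials gs, Commute x m) →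
        ((monomials gs).map fun m => m * x * (m * x)).sum = (c * Q) • (1 : R) := by
      intro x c hxx hx
      rw [mul_smul, ← ih, List.smul_sum, List.map_map]
      congr 1
      refine List.map_congr_left fun m hm => ?_
      have := (hx m hm).eq
      rw [mul_assoc, ← mul_assoc x, this, mul_assoc m x, hxx]
      simp
    have hba : b * a * (b * a) = (-(α * β)) • (1 : R) := by
      have : b * a * (b * a) = -(b * b * (a * a)) := by
        have : a * b = -(b * a) := hab
        rw [mul_assoc, ← mul_assoc a, hab]; simp [mul_assoc]
      rw [this, haa, hbb]; simp [smul_smul]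
    have h1 := key a α haa ca
    have h2 := key b β hbb cb
    have h3 := key (b * a) _ hba fun m hm => (cb m hm).mul_left (ca m hm)
    simp only [monomials, List.map_append, List.sum_append, List.map_map, Function.comp_def,
      mul_assoc] at h1 h2 h3 ih ⊢
    rw [ih, h1, h2, h3, ← add_smul, ← add_smul, ← add_smul]
    congr 1
    ring

theorem sum_trace_mul_trace (h : PairList gs Q)
    (hcent : ∀ z ∈ gs, z * z = -1 → (φ z).trace = 0) :
    ((monomials gs).map fun m => (φ m).trace * (ψ m).trace).sum = (Fintype.card n : ℝ) ^ 2 := by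
  have vanish : ∀ x y : R, (y * y = 1 ∨ y * y = -1) → x * y = -(y * x) → (φ x).trace = 0 := by
    intro x y hy hxy
    have h1 : (φ (x * (y * y))).trace = -(φ (x * (y * y))).trace := by
      conv_lhs => rw [← mul_assoc, hxy, neg_mul, map_neg, trace_neg, mul_assoc, map_mul,
        trace_mul_comm, ← map_mul, mul_assoc]
    have h2 : (φ (x * (y * y))).trace = 0 := by linarith
    rcases hy with hy | hy <;> simpa [hy] using h2
  have sq := h.mul_self_eq
  induction h with
  | nil => simp [monomials]; ring
  | central z hz =>
    simp [monomials, hcent z (by simp) hz]; ring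
  | pair gs Q a b α β h ha hb hab hα hβ haa hbb ih =>
    have ca := commute_monomials ha
    have cb := commute_monomials hb
    have ih' := ih (fun z hz => hcent z (by simp [hz])) fun g hg => sq g (by simp [hg])
    have key : ∀ x y : R, (y * y = 1 ∨ y * y = -1) → x * y = -(y * x) →
        (∀ m ∈ monomials gs, Commute y m) →
        ((monomials gs).map fun m => (φ (m * x)).trace * (ψ (m * x)).trace).sum = 0 := by
      intro x y hy hxy hym
      refine List.sum_eq_zero fun t ht => ?_
      obtain ⟨m, hm, rfl⟩ := List.mem_map.1 ht
      rw [vanish (m * x) y hy, zero_mul]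
      rw [mul_assoc, hxy, ← mul_assoc, (hym m hm).eq]; simp [mul_assoc]
    have h1 := key a b (sq b (by simp)) hab cb
    have h2 := key b a (sq a (by simp)) (by simp [hab]) ca
    have h3 := key (b * a) a (sq a (by simp)) (by rw [← mul_assoc a, hab, neg_mul, neg_neg]) ca
    simp only [monomials, List.map_append, List.sum_append, List.map_map, Function.comp_def,
      mul_assoc] at h1 h2 h3 ih' ⊢
    rw [ih', h1, h2, h3]
    ring

end PairList

end Twirl

section Twirl

open Matrix

variable {n R : Type*} [Fintype n] [DecidableEq n] [Ring R] [Algebra ℝ R]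
  (φ ψ : R →ₐ[ℝ] Matrix n n ℝ)

theorem intertwines_of_mem_adjoin {gs : List R} {X : Matrix n n ℝ}
    (hX : ∀ g ∈ gs, φ g * X = X * ψ g) {x : R} (hx : x ∈ Algebra.adjoin ℝ {g | g ∈ gs}) :
    φ x * X = X * ψ x := by
  induction hx using Algebra.adjoin_induction with
  | mem x hx => exact hX x hx
  | algebraMap r => simp [Algebra.algebraMap_eq_smul_one]
  | add x y _ _ hx hy => simp [Matrix.add_mul, Matrix.mul_add, hx, hy]
  | mul x y _ _ hx hy => rw [map_mul, map_mul, Matrix.mul_assoc, hy, ← Matrix.mul_assoc, hx,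
      Matrix.mul_assoc]

theorem twirl_intertwines {gs : List R} {Q : ℝ} (h : PairList gs Q)
    (ho : ∀ g ∈ gs, φ g * (φ g)ᵀ = 1) (S : Matrix n n ℝ) :
    ∀ g ∈ gs, φ g * twirl φ ψ gs S = twirl φ ψ gs S * ψ g := by
  intro g hg
  conv_lhs => rw [← twirl_invariant φ ψ S gs h.mul_self_eq h.commute_or_anticommute g hg]
  rw [← Matrix.mul_assoc, ← Matrix.mul_assoc, ho g hg, Matrix.one_mul]

theorem single_sandwich_apply (A B : Matrix n n ℝ) (a b i j : n) :
    (Aᵀ * single a b (1 : ℝ) * B) i j = A a i * B b j := by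
  rw [Matrix.mul_assoc, Matrix.mul_apply]
  simp [Matrix.mul_apply, Matrix.single_apply, Finset.sum_ite_eq, ite_and]

theorem sum_single_sandwich (A B : Matrix n n ℝ) :
    ∑ a : n, ∑ b : n, (Aᵀ * single a b (1 : ℝ) * B : Matrix n n ℝ) a b = A.trace * B.trace := by
  simp [single_sandwich_apply, Matrix.trace, Finset.sum_mul_sum]

theorem sum_single_sandwich_swap (A B : Matrix n n ℝ) :
    ∑ a : n, ∑ b : n, (Aᵀ * single b a (1 : ℝ) * B : Matrix n n ℝ) a b = (A * B).trace := by
  simp only [single_sandwich_apply]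
  simp only [Matrix.trace, Matrix.diag_apply, Matrix.mul_apply]
  exact Finset.sum_comm

theorem sum_sum_list_sum {n R : Type*} [Fintype n] (l : List R)
    (F : R → Matrix n n ℝ → Matrix n n ℝ)
    (S : n → n → Matrix n n ℝ) :
    ∑ a, ∑ b, ((l.map fun m => F m (S a b)).sum) a b
      = (l.map fun m => ∑ a, ∑ b, F m (S a b) a b).sum := by
  induction l with
  | nil => simp
  | cons m l ih => simp [Finset.sum_add_distrib, ih]

theorem trace_eq_zero_of_mul_self {M : Matrix n n ℝ} (ho : M * Mᵀ = 1) (hM : M * M = -1) :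
    M.trace = 0 := by
  have h : Mᵀ = -M := by
    have : M * M * Mᵀ = -Mᵀ := by rw [hM, neg_one_mul]
    rw [Matrix.mul_assoc, ho, Matrix.mul_one] at this
    exact (neg_eq_iff_eq_neg.2 this).symm
  have h1 := trace_transpose M
  rw [h, trace_neg] at h1
  linarith

theorem PairList.exists_intertwiner [Nonempty n] {gs : List R} {Q : ℝ} (h : PairList gs Q)
    (ho : ∀ g ∈ gs, φ g * (φ g)ᵀ = 1) :
    ∃ X : Matrix n n ℝ, X ≠ 0 ∧ ∀ g ∈ gs, φ g * X = X * ψ g := by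
  by_contra! hcon
  have h0 : ∀ S, twirl φ ψ gs S = 0 := by
    intro S
    by_contra hS
    obtain ⟨g, hg, hne⟩ := hcon _ hS
    exact hne (twirl_intertwines φ ψ h ho S g hg)
  have h1 := sum_sum_list_sum (monomials gs) (fun m S => (φ m)ᵀ * S * ψ m)
    (fun a b => single a b (1 : ℝ))
  simp only [← twirl_eq_sum, h0, sum_single_sandwich,
    h.sum_trace_mul_trace φ ψ fun z hz hzz =>
      trace_eq_zero_of_mul_self (ho z hz) (by rw [← map_mul, hzz]; simp)] at h1
  have : (0 : ℝ) < Fintype.card n := by exact_mod_cast Fintype.card_pos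
  simp only [Matrix.zero_apply, Finset.sum_const_zero] at h1
  nlinarith

theorem PairList.card_eq [Nonempty n] {gs : List R} {Q : ℝ} (h : PairList gs Q)
    (ho : ∀ g ∈ gs, φ g * (φ g)ᵀ = 1)
    (hirr : ∀ X : Matrix n n ℝ, Xᵀ = X → (∀ g ∈ gs, φ g * X = X * φ g) →
      ∃ c : ℝ, X = c • (1 : Matrix n n ℝ)) :
    (Fintype.card n : ℝ) ^ 2 + Q * Fintype.card n = 2 ^ (gs.length + 1) := by
  have hd : (0 : ℝ) < Fintype.card n := by exact_mod_cast Fintype.card_pos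
  have h0 : ∀ S : Matrix n n ℝ, twirl φ φ gs (S + Sᵀ)
      = (2 ^ (gs.length + 1) * S.trace / Fintype.card n) • (1 : Matrix n n ℝ) := by
    intro S
    obtain ⟨c, hc⟩ := hirr (twirl φ φ gs (S + Sᵀ)) (by
      rw [twirl_transpose, transpose_add, transpose_transpose, add_comm])
      (twirl_intertwines φ φ h ho _)
    have ht := trace_twirl φ (S + Sᵀ) gs ho
    rw [hc] at ht ⊢
    simp only [trace_smul, trace_one, trace_add, trace_transpose, smul_eq_mul] at ht
    congr 1
    field_simp
    rw [ht]; ring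
  have h1 := sum_sum_list_sum (monomials gs) (fun m S => (φ m)ᵀ * S * φ m)
    (fun a b => single a b (1 : ℝ) + (single a b (1 : ℝ))ᵀ)
  simp only [← twirl_eq_sum, h0] at h1
  simp only [transpose_single, Matrix.mul_add, Matrix.add_mul, Matrix.add_apply,
    Finset.sum_add_distrib, sum_single_sandwich, sum_single_sandwich_swap] at h1
  rw [List.sum_map_add, h.sum_trace_mul_trace φ φ fun z hz hzz =>
    trace_eq_zero_of_mul_self (ho z hz) (by rw [← map_mul, hzz]; simp)] at h1
  have h2 : ((monomials gs).map fun m => (φ m * φ m).trace).sum = Q * Fintype.card n := by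
    have := congrArg (fun x => (φ x).trace) h.sum_mul_self
    simp only [map_smul, map_one, trace_smul, trace_one, smul_eq_mul] at this
    rw [← this, map_list_sum, ← Matrix.traceAddMonoidHom_apply, map_list_sum, List.map_map,
      List.map_map]
    simp [Function.comp_def]
  rw [h2] at h1
  rw [← h1]
  have h3 : ∀ a b : n, (single a b (1 : ℝ)).trace = if a = b then 1 else 0 := by
    intro a b
    split_ifs with hab
    · subst hab; simp
    · simp [hab]
  simp only [h3, Matrix.smul_apply, Matrix.one_apply, smul_eq_mul]
  simp
  field_simp

end Twirl

/-- The first `r` members of `K` anticommute pairwise and square to `-1`. -/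
def IsCliffordFamily {R : Type*} [Ring R] (r : ℕ) (K : ℕ → R) : Prop :=
  (∀ i < r, K i * K i = -1) ∧ ∀ i < r, ∀ j < r, i ≠ j → K i * K j = -(K j * K i)

/-- The product `K 0 * ⋯ * K (n - 1)`. -/
def volumeProd {R : Type*} [Ring R] (K : ℕ → R) : ℕ → R
  | 0 => 1
  | n + 1 => volumeProd K n * K n

section Volume

variable {R : Type*} [Ring R] {r : ℕ} {K : ℕ → R}

theorem IsCliffordFamily.mono {m : ℕ} (h : IsCliffordFamily r K) (hm : m ≤ r) :
    IsCliffordFamily m K :=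
  ⟨fun i hi => h.1 i (hi.trans_le hm),
    fun i hi j hj => h.2 i (hi.trans_le hm) j (hj.trans_le hm)⟩

theorem commute_volumeProd {x : R} {n : ℕ} (hx : ∀ i < n, Commute x (K i)) :
    Commute x (volumeProd K n) := by
  induction n with
  | zero => exact Commute.one_right x
  | succ n ih => exact (ih fun i hi => hx i (by omega)).mul_right (hx n (by omega))

theorem mul_volumeProd_of_anticommute {x : R} {n : ℕ} (hx : ∀ i < n, x * K i = -(K i * x)) :
    x * volumeProd K n = (-1) ^ n * (volumeProd K n * x) := by
  induction n with
  | zero => simp [volumeProd]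
  | succ n ih =>
    rw [volumeProd, ← mul_assoc, ih fun i hi => hx i (by omega), mul_assoc, mul_assoc,
      hx n (by omega), pow_succ]
    simp [mul_assoc]

theorem IsCliffordFamily.mul_volumeProd (h : IsCliffordFamily r K) {i : ℕ} (hi : i < r) :
    K i * volumeProd K r = -((-1) ^ r * (volumeProd K r * K i)) := by
  induction r with
  | zero => omega
  | succ n ih =>
    rcases Nat.lt_succ_iff_lt_or_eq.1 hi with hi' | rfl
    · rw [volumeProd, ← mul_assoc, ih (h.mono (by omega)) hi', pow_succ, neg_mul, mul_assoc,
        mul_assoc, h.2 i (by omega) n (by omega) (by omega)]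
      simp [mul_assoc]
    · rw [volumeProd, ← mul_assoc, mul_volumeProd_of_anticommute fun j hj =>
        h.2 i (by omega) j (by omega) (by omega), pow_succ]
      simp [mul_assoc]

theorem IsCliffordFamily.anticommute_volumeProd (h : IsCliffordFamily r K) (hr : Even r) {i : ℕ}
    (hi : i < r) : K i * volumeProd K r = -(volumeProd K r * K i) := by
  simpa [hr.neg_one_pow] using h.mul_volumeProd hi

theorem IsCliffordFamily.commute_volumeProd (h : IsCliffordFamily r K) (hr : Odd r) {i : ℕ}
    (hi : i < r) : Commute (K i) (volumeProd K r) := by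
  have := h.mul_volumeProd hi
  rwa [hr.neg_one_pow, neg_one_mul, neg_neg] at this

theorem commute_volumeProd_of_anticommute {x : R} (hr : Even r)
    (hx : ∀ i < r, x * K i = -(K i * x)) : Commute x (volumeProd K r) := by
  have := mul_volumeProd_of_anticommute hx
  rwa [hr.neg_one_pow, one_mul] at this

theorem volumeProd_mul_self_succ (h : IsCliffordFamily (r + 1) K) :
    volumeProd K (r + 1) * volumeProd K (r + 1)
      = (-1) ^ (r + 1) * (volumeProd K r * volumeProd K r) := by
  have h1 := mul_volumeProd_of_anticommute (x := K r) (K := K) (n := r) fun j hj =>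
    h.2 r (by omega) j (by omega) (by omega)
  have h2 : Commute (volumeProd K r) ((-1) ^ r) := (Commute.neg_one_right _).pow_right _
  calc volumeProd K (r + 1) * volumeProd K (r + 1)
      = volumeProd K r * (K r * volumeProd K r) * K r := by simp [volumeProd, mul_assoc]
    _ = volumeProd K r * (-1) ^ r * volumeProd K r * (K r * K r) := by
        rw [h1]; simp [mul_assoc]
    _ = _ := by rw [h2.eq, h.1 r (by omega), pow_succ]; simp [mul_assoc]

theorem volumeProd_mul_self (h : IsCliffordFamily r K) :
    volumeProd K r * volumeProd K r = if r % 4 = 0 ∨ r % 4 = 3 then 1 else -1 := by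
  induction r with
  | zero => simp [volumeProd]
  | succ n ih =>
    rw [volumeProd_mul_self_succ h, ih (h.mono (by omega))]
    have h4 : n % 4 < 4 := Nat.mod_lt _ (by norm_num)
    rw [neg_one_pow_eq_pow_mod_two, show (n + 1) % 2 = (n % 4 + 1) % 2 by omega,
      show (n + 1) % 4 = (n % 4 + 1) % 4 by omega]
    interval_cases n % 4 <;> simp

theorem volumeProd_mem {A : Submonoid R} {n : ℕ} (h : ∀ i < n, K i ∈ A) :
    volumeProd K n ∈ A := by
  induction n with
  | zero => exact A.one_mem
  | succ n ih => exact A.mul_mem (ih fun i hi => h i (by omega)) (h n (by omega))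

end Volume

/-- The factor by which `j` pairs from a Clifford family change the sum of squares. -/
def pairFactor : ℕ → ℝ
  | 0 => 1
  | j + 1 => pairFactor j * (2 * (-1) ^ (j + 1))

theorem pairFactor_add_four (j : ℕ) : pairFactor (j + 4) = 16 * pairFactor j := by
  simp only [pairFactor, pow_succ]
  have : ((-1 : ℝ) ^ j) ^ 4 = 1 := by rw [← pow_mul, mul_comm, pow_mul]; norm_num
  linear_combination (16 * pairFactor j) * this

theorem pairFactor_four_mul_add (k j : ℕ) : pairFactor (4 * k + j) = 16 ^ k * pairFactor j := by
  induction k with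
  | zero => simp
  | succ k ih =>
    rw [show 4 * (k + 1) + j = 4 * k + j + 4 by ring, pairFactor_add_four, ih]; ring

/-- Extending a pair list by `j` pairs coming from a Clifford family. -/
theorem PairList.extend {R : Type*} [Ring R] [Algebra ℝ R] {gs₀ : List R} {Q₀ : ℝ}
    (h₀ : PairList gs₀ Q₀) {K : ℕ → R} (j : ℕ) (hK : IsCliffordFamily (2 * j) K)
    (hc : ∀ i < 2 * j, ∀ g ∈ gs₀, Commute (K i) g) :
    ∃ gs, PairList gs (Q₀ * pairFactor j) ∧ gs.length = gs₀.length + 2 * j ∧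
      (∀ A : Subalgebra ℝ R, ((∀ g ∈ gs₀, g ∈ A) ∧ ∀ i < 2 * j, K i ∈ A) ↔ ∀ g ∈ gs, g ∈ A) ∧
      ∀ P : Submonoid R, (∀ g ∈ gs₀, g ∈ P) → (∀ i < 2 * j, K i ∈ P) → ∀ g ∈ gs, g ∈ P := by
  induction j with
  | zero => exact ⟨gs₀, by simpa [pairFactor] using h₀, by simp, by simp⟩
  | succ j ih =>
    obtain ⟨gs, h1, h2, h3, h5⟩ := ih (hK.mono (by omega)) fun i hi => hc i (by omega)
    have hK' := hK.mono (m := 2 * j) (by omega)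
    set w := volumeProd K (2 * j) with hw
    have hsq : w * w = ((-1 : ℝ) ^ j) • (1 : R) := by
      rw [hw, volumeProd_mul_self hK']
      rcases Nat.even_or_odd j with hj | hj
      · rw [if_pos (by rcases hj with ⟨k, rfl⟩; omega), hj.neg_one_pow, one_smul]
      · rw [if_neg (by rcases hj with ⟨k, rfl⟩; omega), hj.neg_one_pow, neg_one_smul]
    have hwK : ∀ i, 2 * j ≤ i → i < 2 * (j + 1) → Commute (K i) w := fun i hi hi' =>
      commute_volumeProd_of_anticommute (even_two_mul j) fun l hl =>
        hK.2 i hi' l (by omega) (by omega)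
    have hcomm : ∀ i, 2 * j ≤ i → i < 2 * (j + 1) → ∀ g ∈ gs, Commute (w * K i) g := by
      intro i hi hi'
      have := (h3 (Subalgebra.centralizer ℝ {w * K i})).1 ⟨?_, ?_⟩
      · intro g hg
        exact Subalgebra.mem_centralizer_iff ℝ |>.1 (this g hg) _ rfl
      · intro g hg
        rw [Subalgebra.mem_centralizer_iff]
        rintro _ rfl
        exact ((_root_.commute_volumeProd fun l hl => (hc l (by omega) g hg).symm).symm.mul_left
          (hc i hi' g hg)).eq
      · intro l hl
        rw [Subalgebra.mem_centralizer_iff]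
        rintro _ rfl
        have e1 := hK'.anticommute_volumeProd (even_two_mul j) hl
        have e2 := hK.2 i hi' l (by omega) (by omega)
        rw [← mul_assoc, e1, neg_mul, mul_assoc, mul_assoc, e2, mul_neg]
    have hsqK : ∀ i, 2 * j ≤ i → i < 2 * (j + 1) →
        w * K i * (w * K i) = ((-1 : ℝ) ^ (j + 1)) • (1 : R) := by
      intro i hi hi'
      rw [mul_assoc, ← mul_assoc (K i), (hwK i hi hi').eq, mul_assoc, hK.1 i hi', ← mul_assoc, hsq]
      simp [pow_succ]
    have hpm : (-1 : ℝ) ^ (j + 1) = 1 ∨ (-1 : ℝ) ^ (j + 1) = -1 := neg_one_pow_eq_or ℝ _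
    refine ⟨w * K (2 * j) :: w * K (2 * j + 1) :: gs, ?_, by simp [h2]; ring, ?_, ?_⟩
    · have := PairList.pair gs _ (w * K (2 * j)) (w * K (2 * j + 1)) _ _ h1
        (hcomm _ le_rfl (by omega)) (hcomm _ (by omega) (by omega)) ?_ hpm hpm
        (hsqK _ le_rfl (by omega)) (hsqK _ (by omega) (by omega))
      · convert this using 1
        have : ((-1 : ℝ) ^ (j + 1)) * ((-1 : ℝ) ^ (j + 1)) = 1 := by
          rw [← mul_pow]; norm_num
        rw [pairFactor, this]; ring
      · have e := hK.2 (2 * j) (by omega) (2 * j + 1) (by omega) (by omega)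
        have e1 := (hwK (2 * j) le_rfl (by omega)).eq
        have e2 := (hwK (2 * j + 1) (by omega) (by omega)).eq
        rw [mul_assoc, ← mul_assoc (K _) w, e1, mul_assoc w (K (2 * j)), e, mul_assoc w (K _),
          ← mul_assoc (K _) w, e2]
        simp [mul_assoc]
    · intro A
      simp only [List.forall_mem_cons, ← h3 A]
      have hwA : (∀ i < 2 * j, K i ∈ A) → w ∈ A := fun h => volumeProd_mem (A := A.toSubmonoid) h
      have hKA : ∀ x, w ∈ A → w * x ∈ A → x ∈ A := by
        intro x h h'
        have := A.smul_mem (A.mul_mem h h') ((-1 : ℝ) ^ j)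
        rwa [← mul_assoc, hsq, smul_mul_assoc, one_mul, smul_smul, ← mul_pow,
          neg_one_mul, neg_neg, one_pow, one_smul] at this
      constructor
      · rintro ⟨hg, hk⟩
        have hw' := hwA fun i hi => hk i (by omega)
        exact ⟨A.mul_mem hw' (hk _ (by omega)), A.mul_mem hw' (hk _ (by omega)), hg,
          fun i hi => hk i (by omega)⟩
      · rintro ⟨ha, hb, hg, hk⟩
        refine ⟨hg, fun i hi => ?_⟩
        rcases lt_or_ge i (2 * j) with h | h
        · exact hk i h
        · rcases (by omega : i = 2 * j ∨ i = 2 * j + 1) with rfl | rfl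
          · exact hKA _ (hwA hk) ha
          · exact hKA _ (hwA hk) hb
    · intro P hg hk
      have hwP : w ∈ P := volumeProd_mem fun i hi => hk i (by omega)
      simp only [List.forall_mem_cons]
      exact ⟨P.mul_mem hwP (hk _ (by omega)), P.mul_mem hwP (hk _ (by omega)),
        h5 P hg fun i hi => hk i (by omega)⟩

section Admissible

open Matrix

theorem clifford_combination_mul_self {n : Type*} [Fintype n] [DecidableEq n] {r s : ℕ}
    {J : Fin (r + s) → Matrix n n ℝ}
    (hsq : ∀ i, J i * J i = (-(if (i : ℕ) < r then (1 : ℝ) else -1)) • (1 : Matrix n n ℝ))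
    (hac : ∀ i j, i ≠ j → J i * J j = -(J j * J i)) (Z : Fin (r + s) → ℝ) :
    (∑ i, Z i • J i) * (∑ i, Z i • J i) = (-(sform r s Z Z)) • (1 : Matrix n n ℝ) := by
  have h1 : (∑ i, Z i • J i) * (∑ i, Z i • J i) = ∑ i, ∑ j, (Z i * Z j) • (J i * J j) := by
    rw [Finset.sum_mul_sum]
    simp [smul_smul, mul_comm]
  have h2 : (∑ i, ∑ j, (Z i * Z j) • (J i * J j)) + (∑ i, ∑ j, (Z i * Z j) • (J i * J j))
      = (-(sform r s Z Z)) • (1 : Matrix n n ℝ) + (-(sform r s Z Z)) • (1 : Matrix n n ℝ) := by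
    conv_lhs => arg 2; rw [Finset.sum_comm]
    rw [← Finset.sum_add_distrib]
    have h3 : ∀ i j, (Z i * Z j) • (J i * J j) + (Z j * Z i) • (J j * J i)
        = if i = j then (2 * Z i * Z i) • (J i * J i) else 0 := by
      intro i j
      split_ifs with hij
      · subst hij; rw [← add_smul]; congr 1; ring
      · rw [hac i j hij, mul_comm (Z j)]; simp
    simp only [← Finset.sum_add_distrib, h3, Finset.sum_ite_eq, Finset.mem_univ, if_true, hsq]
    rw [← add_smul, sform, ← Finset.sum_neg_distrib, ← Finset.sum_add_distrib, Finset.sum_smul]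
    refine Finset.sum_congr rfl fun i _ => ?_
    rw [smul_smul]; congr 1; ring
  rw [h1]
  rw [← two_smul ℝ, ← two_smul ℝ] at h2
  exact smul_right_injective _ (two_ne_zero (α := ℝ)) h2

theorem finrank_le_of_invariant {r s : ℕ} {V : Type} [AddCommGroup V] [Module ℝ V]
    {B : V →ₗ[ℝ] V →ₗ[ℝ] ℝ} {JV : (Fin (r + s) → ℝ) →ₗ[ℝ] V →ₗ[ℝ] V}
    (hV : IsMinimalAdmissible r s V B JV) {n : Type} [Fintype n] [DecidableEq n]
    {J : Fin (r + s) → Matrix n n ℝ} {D : Matrix n n ℝ}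
    (hsq : ∀ i, J i * J i = (-(if (i : ℕ) < r then (1 : ℝ) else -1)) • (1 : Matrix n n ℝ))
    (hac : ∀ i j, i ≠ j → J i * J j = -(J j * J i))
    (hD : Dᵀ = D) (hDinj : ∀ v, D *ᵥ v = 0 → v = 0)
    (hskew : ∀ i, (J i)ᵀ * D = -(D * J i))
    (W : Submodule ℝ (n → ℝ)) (hW : W ≠ ⊥) (hJW : ∀ i, ∀ x ∈ W, J i *ᵥ x ∈ W)
    (hDW : ∀ x ∈ W, D *ᵥ x ∈ W) :
    Module.finrank ℝ V ≤ Module.finrank ℝ W := by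
  have hmem : ∀ (Z : Fin (r + s) → ℝ), ∀ x ∈ W, (∑ i, Z i • J i) *ᵥ x ∈ W := by
    intro Z x hx
    rw [Matrix.sum_mulVec]
    refine W.sum_mem fun i _ => ?_
    rw [Matrix.smul_mulVec]
    exact W.smul_mem _ (hJW i x hx)
  let BW : W →ₗ[ℝ] W →ₗ[ℝ] ℝ := LinearMap.mk₂ ℝ (fun x y => (D *ᵥ (x : n → ℝ)) ⬝ᵥ (y : n → ℝ))
    (by intros; simp [Matrix.mulVec_add]) (by intros; simp [Matrix.mulVec_smul])
    (by intros; simp) (by intros; simp)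
  let JW : (Fin (r + s) → ℝ) →ₗ[ℝ] W →ₗ[ℝ] W :=
    LinearMap.mk₂ ℝ (fun Z x => ⟨(∑ i, Z i • J i) *ᵥ (x : n → ℝ), hmem Z x x.2⟩)
    (by intros; ext1; simp [add_smul, Finset.sum_add_distrib, Matrix.add_mulVec])
    (by intros; ext1; simp [← smul_smul, ← Finset.smul_sum, Matrix.smul_mulVec])
    (by intros; ext1; simp [Matrix.mulVec_add]) (by intros; ext1; simp [Matrix.mulVec_smul])
  refine hV.2 W BW JW ⟨inferInstance, Submodule.nontrivial_iff_ne_bot.2 hW, ?_, ?_, ?_, ?_⟩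
  · intro v w
    simp only [BW, LinearMap.mk₂_apply]
    rw [dotProduct_comm, Matrix.dotProduct_mulVec, ← Matrix.mulVec_transpose, hD]
  · intro v hv
    have h := hv ⟨D *ᵥ v, hDW v v.2⟩
    simp only [BW, LinearMap.mk₂_apply] at h
    exact Subtype.ext (hDinj _ (dotProduct_self_eq_zero.1 h))
  · intro Z v
    ext1
    simp only [JW, LinearMap.mk₂_apply, Submodule.coe_smul]
    rw [Matrix.mulVec_mulVec, clifford_combination_mul_self hsq hac, Matrix.smul_mulVec,
      Matrix.one_mulVec]
  · intro Z v w
    simp only [BW, JW, LinearMap.mk₂_apply]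
    have h : (∑ i, Z i • J i)ᵀ * D = -(D * ∑ i, Z i • J i) := by
      simp [Matrix.transpose_sum, Finset.sum_mul, Finset.mul_sum, hskew]
    have h' : D * (∑ i, Z i • J i) = -((∑ i, Z i • J i)ᵀ * D) := by rw [h, neg_neg]
    rw [Matrix.mulVec_mulVec, h', Matrix.neg_mulVec, neg_dotProduct, ← Matrix.mulVec_mulVec,
      Matrix.mulVec_transpose, Matrix.dotProduct_mulVec]

theorem exists_eigenvector_of_transpose_eq {n : Type*} [Fintype n] [DecidableEq n] [Nonempty n]
    {X : Matrix n n ℝ} (hX : Xᵀ = X) : ∃ (μ : ℝ) (v : n → ℝ), v ≠ 0 ∧ X *ᵥ v = μ • v := by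
  have hH : X.IsHermitian := by simpa [Matrix.IsHermitian] using hX
  obtain ⟨i⟩ := ‹Nonempty n›
  refine ⟨hH.eigenvalues i, hH.eigenvectorBasis i, ?_, hH.mulVec_eigenvectorBasis i⟩
  intro h
  exact hH.eigenvectorBasis.orthonormal.ne_zero i (by ext j; exact congrFun h j)

/-- The eigenspace of a matrix, as a subspace of `n → ℝ`. -/
def eigenSubmodule {n : Type*} [Fintype n] [DecidableEq n] (X : Matrix n n ℝ) (μ : ℝ) :
    Submodule ℝ (n → ℝ) := LinearMap.ker (Matrix.toLin' (X - μ • 1))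

theorem mem_eigenSubmodule {n : Type*} [Fintype n] [DecidableEq n] {X : Matrix n n ℝ} {μ : ℝ}
    {v : n → ℝ} : v ∈ eigenSubmodule X μ ↔ X *ᵥ v = μ • v := by
  simp [eigenSubmodule, sub_eq_zero]

theorem mulVec_mem_eigenSubmodule {n : Type*} [Fintype n] [DecidableEq n] {X Y : Matrix n n ℝ}
    {μ : ℝ} (h : Commute X Y) {v : n → ℝ} (hv : v ∈ eigenSubmodule X μ) :
    Y *ᵥ v ∈ eigenSubmodule X μ := by
  rw [mem_eigenSubmodule] at hv ⊢
  rw [Matrix.mulVec_mulVec, h.eq, ← Matrix.mulVec_mulVec, hv, Matrix.mulVec_smul]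

theorem eq_smul_one_of_eigenSubmodule_eq_top {n : Type*} [Fintype n] [DecidableEq n]
    {X : Matrix n n ℝ} {μ : ℝ} (h : eigenSubmodule X μ = ⊤) : X = μ • 1 := by
  rw [eigenSubmodule, LinearMap.ker_eq_top] at h
  exact sub_eq_zero.1 ((LinearEquiv.map_eq_zero_iff Matrix.toLin').1 h)

theorem eigenSubmodule_ne_bot {n : Type*} [Fintype n] [DecidableEq n]
    {X : Matrix n n ℝ} {μ : ℝ} {v : n → ℝ} (hv : v ≠ 0) (h : X *ᵥ v = μ • v) :
    eigenSubmodule X μ ≠ ⊥ :=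
  fun hb => hv ((Submodule.eq_bot_iff _).1 hb v (mem_eigenSubmodule.2 h))

/-- Two Clifford families of skew matrices commuting with each other, together with a symmetric
involution commuting with the first family and anticommuting with the second one. -/
structure IsCliffordSystem_s8 {n : Type*} [Fintype n] [DecidableEq n] (r s : ℕ)
    (K L : ℕ → Matrix n n ℝ) (D : Matrix n n ℝ) : Prop where
  transpose_left : ∀ i < r, (K i)ᵀ = -K i
  transpose_right : ∀ i < s, (L i)ᵀ = -L i
  left : IsCliffordFamily r K
  right : IsCliffordFamily s L
  comm : ∀ i < r, ∀ j < s, Commute (K i) (L j)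
  transpose_inv : Dᵀ = D
  inv_mul_self : D * D = 1
  comm_left : ∀ i < r, Commute D (K i)
  anticomm_right : ∀ i < s, D * L i = -(L i * D)

/-- The concatenation of two families indexed by `Fin (r + s)`. -/
def joinFamily {R : Type*} (r s : ℕ) (K L : ℕ → R) (i : Fin (r + s)) : R :=
  if (i : ℕ) < r then K i else L (i - r)

theorem IsCliffordSystem_s8.finrank_le {n : Type} [Fintype n] [DecidableEq n] {r s : ℕ}
    {K L : ℕ → Matrix n n ℝ} {D : Matrix n n ℝ} (h : IsCliffordSystem_s8 r s K L D)
    {V : Type} [AddCommGroup V] [Module ℝ V]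
    {B : V →ₗ[ℝ] V →ₗ[ℝ] ℝ} {JV : (Fin (r + s) → ℝ) →ₗ[ℝ] V →ₗ[ℝ] V}
    (hV : IsMinimalAdmissible r s V B JV)
    (W : Submodule ℝ (n → ℝ)) (hW : W ≠ ⊥) (hKW : ∀ i < r, ∀ x ∈ W, K i *ᵥ x ∈ W)
    (hLW : ∀ i < s, ∀ x ∈ W, L i *ᵥ x ∈ W) (hDW : ∀ x ∈ W, D *ᵥ x ∈ W) :
    Module.finrank ℝ V ≤ Module.finrank ℝ W := by
  have hsub : ∀ i : Fin (r + s), ¬ (i : ℕ) < r → (i : ℕ) - r < s := fun i hi => by omega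
  have hD := h.inv_mul_self
  refine finrank_le_of_invariant hV (J := fun i => D * joinFamily r s K L i) (D := D)
    ?_ ?_ h.transpose_inv ?_ ?_ W hW ?_ hDW
  · intro i
    simp only [joinFamily]
    split_ifs with hi
    · rw [mul_assoc, ← mul_assoc (K _), ← (h.comm_left _ hi).eq, mul_assoc, h.left.1 _ hi,
        ← mul_assoc, hD]; simp
    · have e := h.anticomm_right _ (hsub i hi)
      have e' : L (i - r) * D = -(D * L (i - r)) := by rw [e, neg_neg]
      rw [mul_assoc, ← mul_assoc (L _), e', neg_mul, mul_assoc, h.right.1 _ (hsub i hi),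
        mul_neg, ← mul_assoc, hD]; simp
  · intro i j hij
    have hij' : (i : ℕ) ≠ j := fun e => hij (Fin.ext e)
    have kk : ∀ X Y : Matrix n n ℝ, Commute D X → D * X * (D * Y) = X * Y := by
      intro X Y hX
      rw [hX.eq, mul_assoc, ← mul_assoc D, hD, one_mul]
    have ll : ∀ X Y : Matrix n n ℝ, D * X = -(X * D) → D * X * (D * Y) = -(X * Y) := by
      intro X Y hX
      rw [hX, neg_mul, mul_assoc, ← mul_assoc D, hD, one_mul]
    simp only [joinFamily]
    split_ifs with hi hj hj
    · rw [kk _ _ (h.comm_left _ hi), kk _ _ (h.comm_left _ hj), h.left.2 _ hi _ hj hij']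
    · rw [kk _ _ (h.comm_left _ hi), ll _ _ (h.anticomm_right _ (hsub j hj)),
        (h.comm _ hi _ (hsub j hj)).eq, neg_neg]
    · rw [ll _ _ (h.anticomm_right _ (hsub i hi)), kk _ _ (h.comm_left _ hj),
        (h.comm _ hj _ (hsub i hi)).eq]
    · rw [ll _ _ (h.anticomm_right _ (hsub i hi)), ll _ _ (h.anticomm_right _ (hsub j hj)),
        h.right.2 _ (hsub i hi) _ (hsub j hj) (by omega)]
  · intro v hv
    have := congrArg (D *ᵥ ·) hv
    simpa [Matrix.mulVec_mulVec, hD] using this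
  · intro i
    have ht : (joinFamily r s K L i)ᵀ = -joinFamily r s K L i := by
      simp only [joinFamily]
      split_ifs with hi
      · exact h.transpose_left _ hi
      · exact h.transpose_right _ (hsub i hi)
    rw [transpose_mul, h.transpose_inv, ht, mul_assoc, ← mul_assoc D, hD]
    simp
  · intro i x hx
    rw [← Matrix.mulVec_mulVec]
    refine hDW _ ?_
    simp only [joinFamily]
    split_ifs with hi
    · exact hKW _ hi x hx
    · exact hLW _ (hsub i hi) x hx

end Admissible

section NormalForm

open Matrix

theorem sform_single_left {r s : ℕ} (i : Fin (r + s)) (W : Fin (r + s) → ℝ) :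
    sform r s (Pi.single i 1) W = (if (i : ℕ) < r then (1 : ℝ) else -1) * W i := by
  rw [sform, Finset.sum_eq_single i] <;> simp +contextual

theorem sform_add_self {r s : ℕ} (Z W : Fin (r + s) → ℝ) :
    sform r s (Z + W) (Z + W) = sform r s Z Z + sform r s W W + 2 * sform r s Z W := by
  simp only [sform, Finset.mul_sum, ← Finset.sum_add_distrib, Pi.add_apply]
  exact Finset.sum_congr rfl fun i _ => by ring

theorem Matrix.ext_of_dotProduct_mulVec {n : Type*} [Fintype n] [DecidableEq n]
    {A B : Matrix n n ℝ} (h : ∀ x y : n → ℝ, x ⬝ᵥ A *ᵥ y = x ⬝ᵥ B *ᵥ y) : A = B := by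
  ext i j
  simpa using h (Pi.single i 1) (Pi.single j 1)

theorem IsAdmissible.exists_matrices {r s : ℕ} {V : Type} [AddCommGroup V] [Module ℝ V]
    {B : V →ₗ[ℝ] V →ₗ[ℝ] ℝ} {J : (Fin (r + s) → ℝ) →ₗ[ℝ] V →ₗ[ℝ] V}
    (hV : IsAdmissible r s V B J) :
    ∃ (M : Fin (r + s) → Matrix (Fin (Module.finrank ℝ V)) (Fin (Module.finrank ℝ V)) ℝ)
      (β : Matrix (Fin (Module.finrank ℝ V)) (Fin (Module.finrank ℝ V)) ℝ)
      (e : V ≃ₗ[ℝ] (Fin (Module.finrank ℝ V) → ℝ)),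
      (∀ i, M i * M i = (-(if (i : ℕ) < r then (1 : ℝ) else -1)) • 1) ∧
      (∀ i j, i ≠ j → M i * M j = -(M j * M i)) ∧ βᵀ = β ∧ (∀ v, β *ᵥ v = 0 → v = 0) ∧
      (∀ i, (M i)ᵀ * β = -(β * M i)) ∧ (∀ v w, B v w = e v ⬝ᵥ β *ᵥ e w) ∧
      (∀ i v, e (J (Pi.single i 1) v) = M i *ᵥ e v) := by
  obtain ⟨hfin, -, hsymm, hnd, hsq, hskew⟩ := hV
  let e := (Module.finBasis ℝ V).equivFun
  let M := fun i => LinearMap.toMatrix' (e.conj (J (Pi.single i 1)))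
  let β := LinearMap.toMatrix₂' ℝ (B.compl₁₂ e.symm.toLinearMap e.symm.toLinearMap)
  have hM : ∀ i v, e (J (Pi.single i 1) v) = M i *ᵥ e v := by
    intro i v
    rw [← Matrix.toLin'_apply]
    simp [M, LinearEquiv.conj_apply]
  have hβ : ∀ v w, B v w = e v ⬝ᵥ β *ᵥ e w := by
    intro v w
    rw [← Matrix.toLinearMap₂'_apply']
    simp [β]
  have hext : ∀ A A' : Matrix (Fin (Module.finrank ℝ V)) (Fin (Module.finrank ℝ V)) ℝ,
      (∀ v, A *ᵥ e v = A' *ᵥ e v) → A = A' := by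
    intro A A' h
    refine Matrix.ext_of_dotProduct_mulVec fun x y => ?_
    have := h (e.symm y)
    rw [e.apply_symm_apply] at this
    rw [this]
  have hext₂ : ∀ A A' : Matrix (Fin (Module.finrank ℝ V)) (Fin (Module.finrank ℝ V)) ℝ,
      (∀ v w, e v ⬝ᵥ A *ᵥ e w = e v ⬝ᵥ A' *ᵥ e w) → A = A' := by
    intro A A' h
    refine Matrix.ext_of_dotProduct_mulVec fun x y => ?_
    simpa using h (e.symm x) (e.symm y)
  have hσ : ∀ i : Fin (r + s), sform r s (Pi.single i 1) (Pi.single i 1)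
      = if (i : ℕ) < r then (1 : ℝ) else -1 := by
    intro i; simp [sform_single_left]
  have ht : βᵀ = β := hext₂ _ _ fun v w => by
    rw [Matrix.mulVec_transpose, dotProduct_comm, ← Matrix.dotProduct_mulVec, ← hβ, ← hβ, hsymm]
  refine ⟨M, β, e, ?_, ?_, ht, ?_, ?_, hβ, hM⟩
  · intro i
    refine hext _ _ fun v => ?_
    rw [← Matrix.mulVec_mulVec, ← hM, ← hM, hsq, hσ, map_smul, Matrix.smul_mulVec,
      Matrix.one_mulVec]
  · intro i j hij
    refine hext _ _ fun v => ?_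
    rw [Matrix.neg_mulVec, ← Matrix.mulVec_mulVec, ← Matrix.mulVec_mulVec, ← hM, ← hM, ← hM,
      ← hM, ← map_neg]
    congr 1
    have h := hsq (Pi.single i 1 + Pi.single j 1) v
    simp only [map_add, LinearMap.add_apply, hsq, sform_add_self] at h
    have hij0 : sform r s (Pi.single i 1) (Pi.single j 1) = 0 := by
      rw [sform_single_left, Pi.single_eq_of_ne hij, mul_zero]
    rw [hij0, mul_zero, add_zero, neg_add, add_smul] at h
    rw [eq_neg_iff_add_eq_zero]
    have h' : ∀ a b c d : V, a + b + (c + d) = a + d → c + b = 0 := by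
      intro a b c d h; rw [← sub_eq_zero] at h; rw [← h]; abel
    exact h' _ _ _ _ (by rw [← h])
  · intro v hv
    have : e.symm v = 0 := hnd _ fun w => by
      rw [hsymm, hβ]; simp [hv]
    simpa using this
  · intro i
    refine hext₂ _ _ fun v w => ?_
    have h := hskew (Pi.single i 1) v w
    rw [hβ, hβ, hM, hM] at h
    rw [Matrix.neg_mulVec, dotProduct_neg, ← Matrix.mulVec_mulVec, ← Matrix.mulVec_mulVec, ← h,
      Matrix.mulVec_transpose, dotProduct_comm, ← Matrix.dotProduct_mulVec, dotProduct_comm]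

open scoped MatrixOrder Matrix.Norms.L2Operator in
theorem Matrix.PosDef.exists_eq_transpose_mul_self {n : Type*} [Fintype n] [DecidableEq n]
    {G : Matrix n n ℝ} (hG : G.PosDef) : ∃ C : Matrix n n ℝ, G = Cᵀ * C := by
  obtain ⟨C, hC⟩ := CStarAlgebra.nonneg_iff_eq_star_mul_self.1 hG.posSemidef.nonneg
  exact ⟨C, by rw [hC, Matrix.star_eq_conjTranspose,
    Matrix.conjTranspose_eq_transpose_of_trivial]⟩

theorem IsAdmissible.exists_orthogonal_matrices {r s : ℕ} {V : Type} [AddCommGroup V] [Module ℝ V]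
    {B : V →ₗ[ℝ] V →ₗ[ℝ] ℝ} {J : (Fin (r + s) → ℝ) →ₗ[ℝ] V →ₗ[ℝ] V}
    (hV : IsAdmissible r s V B J) :
    ∃ (M : Fin (r + s) → Matrix (Fin (Module.finrank ℝ V)) (Fin (Module.finrank ℝ V)) ℝ)
      (β : Matrix (Fin (Module.finrank ℝ V)) (Fin (Module.finrank ℝ V)) ℝ)
      (e : V ≃ₗ[ℝ] (Fin (Module.finrank ℝ V) → ℝ)),
      (∀ i, M i * M i = (-(if (i : ℕ) < r then (1 : ℝ) else -1)) • 1) ∧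
      (∀ i j, i ≠ j → M i * M j = -(M j * M i)) ∧ βᵀ = β ∧ (∀ v, β *ᵥ v = 0 → v = 0) ∧
      (∀ i, (M i)ᵀ * β = -(β * M i)) ∧ (∀ v w, B v w = e v ⬝ᵥ β *ᵥ e w) ∧
      (∀ i v, e (J (Pi.single i 1) v) = M i *ᵥ e v) ∧ ∀ i, (M i)ᵀ * M i = 1 := by
  obtain ⟨M, β, e, hsq, hac, hβ, hinj, hskew, hB, hJ⟩ := hV.exists_matrices
  let φ := AlgHom.id ℝ (Matrix (Fin (Module.finrank ℝ V)) (Fin (Module.finrank ℝ V)) ℝ)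
  have hG : (twirl φ φ (List.ofFn M) 1).PosDef := twirl_posDef φ _ Matrix.PosDef.one
  have hMG : ∀ i, (M i)ᵀ * twirl φ φ (List.ofFn M) 1 * M i = twirl φ φ (List.ofFn M) 1 := by
    intro i
    refine twirl_invariant φ φ 1 _ ?_ ?_ (M i) (by simp)
    · simp only [List.forall_mem_ofFn_iff]
      intro i
      rw [hsq]
      split_ifs <;> simp
    · simp only [List.forall_mem_ofFn_iff]
      intro i j
      by_cases hij : i = j
      · exact Or.inl (by rw [hij])
      · exact Or.inr (hac i j hij)
  generalize twirl φ φ (List.ofFn M) 1 = G at hG hMG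
  obtain ⟨C, hC⟩ := hG.exists_eq_transpose_mul_self
  have hCu : IsUnit C.det := by
    have h := hG.det_pos
    rw [hC, Matrix.det_mul, Matrix.det_transpose] at h
    exact isUnit_iff_ne_zero.2 fun h0 => by simp [h0] at h
  have c1 : C * C⁻¹ = 1 := Matrix.mul_nonsing_inv C hCu
  have c2 : C⁻¹ * C = 1 := Matrix.nonsing_inv_mul C hCu
  have c3 : C⁻¹ᵀ * Cᵀ = 1 := by rw [← Matrix.transpose_mul, c1, Matrix.transpose_one]
  have c4 : Cᵀ * C⁻¹ᵀ = 1 := by rw [← Matrix.transpose_mul, c2, Matrix.transpose_one]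
  have conj : ∀ X Y : Matrix (Fin (Module.finrank ℝ V)) (Fin (Module.finrank ℝ V)) ℝ,
      C * X * C⁻¹ * (C * Y * C⁻¹) = C * (X * Y) * C⁻¹ := by
    intro X Y
    calc _ = C * X * (C⁻¹ * C) * Y * C⁻¹ := by simp only [Matrix.mul_assoc]
      _ = _ := by rw [c2]; simp only [Matrix.mul_assoc, Matrix.one_mul]
  refine ⟨fun i => C * M i * C⁻¹, C⁻¹ᵀ * β * C⁻¹,
    e.trans (Matrix.toLin'OfInv c2 c1), ?_, ?_, ?_, ?_, ?_, ?_, ?_, ?_⟩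
  · intro i
    simp [conj, hsq, c1]
  · intro i j hij
    simp [conj, hac i j hij]
  · simp [Matrix.mul_assoc, hβ]
  · intro v hv
    have h1 := congrArg (Cᵀ *ᵥ ·) hv
    simp only [Matrix.mulVec_mulVec, Matrix.mulVec_zero, ← Matrix.mul_assoc, c4,
      Matrix.one_mul] at h1
    rw [← Matrix.mulVec_mulVec] at h1
    have h2 := congrArg (C *ᵥ ·) (hinj _ h1)
    simpa [Matrix.mulVec_mulVec, c1] using h2
  · intro i
    calc (C * M i * C⁻¹)ᵀ * (C⁻¹ᵀ * β * C⁻¹)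
        = C⁻¹ᵀ * ((M i)ᵀ * (Cᵀ * C⁻¹ᵀ) * β) * C⁻¹ := by
          simp only [Matrix.transpose_mul, Matrix.mul_assoc]
      _ = -(C⁻¹ᵀ * β * (C⁻¹ * C) * M i * C⁻¹) := by
          rw [c4, c2, Matrix.mul_one, Matrix.mul_one, hskew]
          simp only [Matrix.mul_neg, Matrix.neg_mul, Matrix.mul_assoc]
      _ = _ := by simp only [Matrix.mul_assoc]
  · intro v w
    have h1 : ∀ v, (e.trans (Matrix.toLin'OfInv c2 c1)) v = C *ᵥ e v := fun v =>
      Matrix.toLin'_apply C (e v)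
    have h2 : ∀ v, C⁻¹ *ᵥ (C *ᵥ v) = v := fun v => by
      rw [Matrix.mulVec_mulVec, c2, Matrix.one_mulVec]
    rw [h1, h1, hB, ← Matrix.mulVec_mulVec, h2, ← Matrix.mulVec_mulVec, Matrix.mulVec_transpose,
      dotProduct_comm (C *ᵥ _), ← Matrix.dotProduct_mulVec, h2, dotProduct_comm]
  · intro i v
    have h1 : ∀ v, (e.trans (Matrix.toLin'OfInv c2 c1)) v = C *ᵥ e v := fun v =>
      Matrix.toLin'_apply C (e v)
    rw [h1, h1, hJ, Matrix.mulVec_mulVec, Matrix.mulVec_mulVec, Matrix.mul_assoc, c2,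
      Matrix.mul_one]
  · intro i
    calc (C * M i * C⁻¹)ᵀ * (C * M i * C⁻¹)
        = C⁻¹ᵀ * ((M i)ᵀ * (Cᵀ * C) * M i) * C⁻¹ := by
          simp only [Matrix.transpose_mul, Matrix.mul_assoc]
      _ = (C⁻¹ᵀ * Cᵀ) * (C * C⁻¹) := by rw [← hC, hMG, hC]; simp only [Matrix.mul_assoc]
      _ = 1 := by rw [c1, c3, Matrix.one_mul]

theorem IsMinimalAdmissible.exists_cliffordSystem {r s : ℕ} {V : Type} [AddCommGroup V]
    [Module ℝ V] {B : V →ₗ[ℝ] V →ₗ[ℝ] ℝ} {J : (Fin (r + s) → ℝ) →ₗ[ℝ] V →ₗ[ℝ] V}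
    (hV : IsMinimalAdmissible r s V B J) :
    ∃ (K L : ℕ → Matrix (Fin (Module.finrank ℝ V)) (Fin (Module.finrank ℝ V)) ℝ)
      (D : Matrix (Fin (Module.finrank ℝ V)) (Fin (Module.finrank ℝ V)) ℝ)
      (e : V ≃ₗ[ℝ] (Fin (Module.finrank ℝ V) → ℝ)) (c : ℝ), c ≠ 0 ∧
      IsCliffordSystem_s8 r s K L D ∧
      ∀ i v w, B (J (Pi.single i 1) v) w = c * ((joinFamily r s K L i *ᵥ e v) ⬝ᵥ e w) := by
  obtain ⟨M, β, e, hsq, hac, hβ, hinj, hskew, hB, hJ, hM⟩ := hV.1.exists_orthogonal_matrices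
  have := hV.1.1
  have : Nontrivial V := hV.1.2.1
  have : Nonempty (Fin (Module.finrank ℝ V)) := Fin.pos_iff_nonempty.1 Module.finrank_pos
  let σ : Fin (r + s) → ℝ := fun i => if (i : ℕ) < r then (1 : ℝ) else -1
  have hsq' : ∀ i, M i * M i = (-σ i) • 1 := hsq
  have hσσ : ∀ i, σ i * σ i = 1 := by intro i; simp only [σ]; split_ifs <;> norm_num
  have hMt : ∀ i, (M i)ᵀ = (-σ i) • M i := by
    intro i
    have h : (M i)ᵀ * (M i * M i) = M i := by rw [← Matrix.mul_assoc, hM, Matrix.one_mul]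
    rw [hsq', Matrix.mul_smul, Matrix.mul_one] at h
    conv_rhs => rw [← h, smul_smul, neg_mul_neg, hσσ, one_smul]
  have hβM : ∀ i, β * M i = σ i • (M i * β) := by
    intro i
    have h := hskew i
    rw [hMt, Matrix.smul_mul, neg_smul, neg_inj] at h
    exact h.symm
  have hββ : ∀ i, Commute (β * β) (M i) := by
    intro i
    rw [commute_iff_eq, mul_assoc, hβM, mul_smul_comm, ← mul_assoc, hβM, smul_mul_assoc, smul_smul,
      hσσ,
      one_smul, mul_assoc]
  obtain ⟨c, hc, hcβ⟩ : ∃ c : ℝ, c ≠ 0 ∧ β * β = (c * c) • 1 := by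
    obtain ⟨μ, v, hv, hμ⟩ := exists_eigenvector_of_transpose_eq (X := β * β) (by
      rw [transpose_mul, hβ])
    have h1 := finrank_le_of_invariant hV hsq hac hβ hinj hskew (eigenSubmodule (β * β) μ)
      (eigenSubmodule_ne_bot hv hμ) (fun i x hx => mulVec_mem_eigenSubmodule (hββ i) hx)
      (fun x hx => mulVec_mem_eigenSubmodule ((Commute.refl β).mul_left (Commute.refl β)) hx)
    have h2 := eq_smul_one_of_eigenSubmodule_eq_top (Submodule.eq_top_of_finrank_eq
      (le_antisymm (Submodule.finrank_le _) (by rwa [Module.finrank_fin_fun])))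
    have h3 : 0 < μ := by
      have hpos : ∀ w : Fin (Module.finrank ℝ V) → ℝ, w ≠ 0 → 0 < w ⬝ᵥ w := fun w hw =>
        (Finset.sum_nonneg fun i _ => mul_self_nonneg (w i)).lt_of_ne
          fun h => hw (dotProduct_self_eq_zero.1 h.symm)
      have p1 := hpos (β *ᵥ v) fun h => hv (hinj v h)
      rw [Matrix.dotProduct_mulVec, ← Matrix.mulVec_transpose, hβ, Matrix.mulVec_mulVec, hμ,
        smul_dotProduct, smul_eq_mul] at p1
      exact pos_of_mul_pos_left p1 (hpos v hv).le
    exact ⟨√μ, (Real.sqrt_pos.2 h3).ne', by rw [Real.mul_self_sqrt h3.le, h2]⟩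
  have hcc : c⁻¹ * c⁻¹ * (c * c) = 1 := by field_simp
  have hDD : (c⁻¹ • β) * (c⁻¹ • β) = 1 := by
    rw [smul_mul_smul_comm, hcβ, smul_smul, hcc, one_smul]
  have hDM : ∀ i, (c⁻¹ • β) * M i = σ i • (M i * (c⁻¹ • β)) := by
    intro i; rw [smul_mul_assoc, hβM, mul_smul_comm, smul_comm]
  have hDt : (c⁻¹ • β)ᵀ = c⁻¹ • β := by rw [transpose_smul, hβ]
  have hBD : ∀ v w, B v w = c * (e v ⬝ᵥ (c⁻¹ • β) *ᵥ e w) := by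
    intro v w
    rw [hB, Matrix.smul_mulVec, dotProduct_smul, smul_eq_mul, mul_inv_cancel_left₀ hc]
  generalize c⁻¹ • β = D at hDD hDM hDt hBD
  have prod : ∀ i j, D * M i * (D * M j) = σ i • (M i * M j) := by
    intro i j
    rw [hDM, smul_mul_assoc, mul_assoc, ← mul_assoc D, hDD, one_mul]
  have hDD' : ∀ i, D * (D * M i) = σ i • (D * M i * D) := by
    intro i
    rw [hDM, mul_smul_comm, ← mul_assoc, hDM, smul_mul_assoc]
  have ht : ∀ i, (D * M i)ᵀ = -(D * M i) := by
    intro i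
    rw [transpose_mul, hDt, hMt, smul_mul_assoc, hDM, neg_smul]
  let g : ℕ → Matrix (Fin (Module.finrank ℝ V)) (Fin (Module.finrank ℝ V)) ℝ :=
    fun i => if h : i < r + s then D * M ⟨i, h⟩ else 0
  have hg : ∀ i (h : i < r + s), g i = D * M ⟨i, h⟩ := fun i h => dif_pos h
  have hl : ∀ i (h : i < r) (h' : i < r + s), σ ⟨i, h'⟩ = 1 := fun i h h' => if_pos h
  have hr : ∀ i (h' : r + i < r + s), σ ⟨r + i, h'⟩ = -1 := fun i h' => if_neg (by simp)
  have hg' : ∀ i (h : r + i < r + s), (fun i => g (r + i)) i = D * M ⟨r + i, h⟩ :=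
    fun i h => hg _ h
  refine ⟨g, fun i => g (r + i), D, e, c, hc, ⟨?_, ?_, ⟨?_, ?_⟩, ⟨?_, ?_⟩, ?_, hDt, hDD, ?_, ?_⟩,
    ?_⟩
  · intro i hi
    rw [hg i (by omega), ht]
  · intro i hi
    rw [hg _ (by omega), ht]
  · intro i hi
    rw [hg i (by omega), prod, hsq', smul_smul, mul_neg, hσσ, neg_one_smul]
  · intro i hi j hj hij
    rw [hg i (by omega), hg j (by omega), prod, prod, hl i hi, hl j hj, one_smul, one_smul]
    exact hac _ _ (by simpa using hij)
  · intro i hi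
    rw [hg' i (by omega), prod, hsq', smul_smul, mul_neg, hσσ, neg_one_smul]
  · intro i hi j hj hij
    rw [hg' i (by omega), hg' j (by omega), prod, prod, hr _ (by omega), hr _ (by omega),
      hac ⟨r + i, by omega⟩ _ (by simpa using hij)]
    simp
  · intro i hi j hj
    rw [commute_iff_eq, hg _ (by omega), hg _ (by omega), prod, prod, hr _ (by omega), hl i hi,
      hac ⟨i, by omega⟩ _ (by simp; omega)]
    simp
  · intro i hi
    rw [commute_iff_eq, hg _ (by omega), hDD', hl i hi, one_smul]
  · intro i hi
    rw [hg _ (by omega), hDD', hr i, neg_one_smul]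
  · intro i v w
    have h1 : joinFamily r s g (fun i => g (r + i)) i = D * M i := by
      simp only [joinFamily]
      split_ifs with h
      · exact hg i i.2
      · have : r + ((i : ℕ) - r) = i := by omega
        rw [this]; exact hg i i.2
    rw [h1, hBD, hJ, ← Matrix.mulVec_mulVec, Matrix.dotProduct_mulVec, ← Matrix.mulVec_transpose,
      hDt]

end NormalForm

section CliffordSystem

open Matrix

/-- Two Clifford families commuting with each other. -/
structure IsCliffordPair {R : Type*} [Ring R] (r s : ℕ) (K L : ℕ → R) : Prop where
  left : IsCliffordFamily r K
  right : IsCliffordFamily s L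
  comm : ∀ i < r, ∀ j < s, Commute (K i) (L j)

theorem IsCliffordPair.mono {R : Type*} [Ring R] {r r' s : ℕ} {K L : ℕ → R}
    (h : IsCliffordPair r s K L) (hr : r' ≤ r) : IsCliffordPair r' s K L :=
  ⟨h.left.mono hr, h.right, fun i hi => h.comm i (hi.trans_le hr)⟩

theorem IsCliffordPair.swap {R : Type*} [Ring R] {r s : ℕ} {K L : ℕ → R}
    (h : IsCliffordPair r s K L) : IsCliffordPair s r L K :=
  ⟨h.right, h.left, fun i hi j hj => (h.comm j hj i hi).symm⟩

variable {n : Type*} [Fintype n] [DecidableEq n] {r s : ℕ} {K L : ℕ → Matrix n n ℝ}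
  {D : Matrix n n ℝ}

theorem transpose_eq_of_mul_self {M : Matrix n n ℝ} (ho : M ∈ orthogonalGroup n ℝ)
    (hM : M * M = 1) : Mᵀ = M := by
  rw [mem_orthogonalGroup_iff] at ho
  calc Mᵀ = M * M * Mᵀ := by rw [hM, one_mul]
    _ = M := by rw [mul_assoc, ho, mul_one]

theorem mem_orthogonalGroup_of_transpose_eq_neg {M : Matrix n n ℝ} (ht : Mᵀ = -M)
    (hM : M * M = -1) : M ∈ orthogonalGroup n ℝ := by
  rw [mem_orthogonalGroup_iff, ht, mul_neg, hM, neg_neg]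

theorem IsCliffordPair.toCliffordSystem (h : IsCliffordPair r s K L)
    (hK : ∀ i < r, (K i)ᵀ = -K i) (hL : ∀ i < s, (L i)ᵀ = -L i) (hs : s % 4 = 0) :
    IsCliffordSystem_s8 r s K L (volumeProd L s) := by
  have hsq : volumeProd L s * volumeProd L s = 1 := by
    rw [volumeProd_mul_self h.right, if_pos (Or.inl hs)]
  refine ⟨hK, hL, h.left, h.right, h.comm, ?_, hsq, ?_, ?_⟩
  · exact transpose_eq_of_mul_self (volumeProd_mem fun i hi =>
      mem_orthogonalGroup_of_transpose_eq_neg (hL i hi) (h.right.1 i hi)) hsq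
  · exact fun i hi => (commute_volumeProd fun j hj => h.comm i hi j hj).symm
  · intro i hi
    rw [h.right.anticommute_volumeProd (Nat.even_iff.2 (by omega)) hi, neg_neg]

namespace IsCliffordSystem_s8

theorem pair (h : IsCliffordSystem_s8 r s K L D) : IsCliffordPair r s K L :=
  ⟨h.left, h.right, h.comm⟩

theorem left_mem (h : IsCliffordSystem_s8 r s K L D) {i : ℕ} (hi : i < r) :
    K i ∈ orthogonalGroup n ℝ :=
  mem_orthogonalGroup_of_transpose_eq_neg (h.transpose_left i hi) (h.left.1 i hi)

theorem right_mem (h : IsCliffordSystem_s8 r s K L D) {i : ℕ} (hi : i < s) :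
    L i ∈ orthogonalGroup n ℝ :=
  mem_orthogonalGroup_of_transpose_eq_neg (h.transpose_right i hi) (h.right.1 i hi)

theorem inv_mem (h : IsCliffordSystem_s8 r s K L D) : D ∈ orthogonalGroup n ℝ := by
  rw [mem_orthogonalGroup_iff, h.transpose_inv, h.inv_mul_self]

theorem volume_right (h : IsCliffordSystem_s8 r s K L D) (hs : s % 4 = 0) :
    IsCliffordSystem_s8 r s K L (volumeProd L s) :=
  h.pair.toCliffordSystem h.transpose_left h.transpose_right hs

theorem volume_left (h : IsCliffordSystem_s8 r s K L D) (hr : r % 4 = 0) :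
    IsCliffordSystem_s8 s r L K (volumeProd K r) :=
  h.pair.swap.toCliffordSystem h.transpose_right h.transpose_left hr

theorem exists_eq_smul_one {n : Type} [Fintype n] [DecidableEq n] [Nonempty n]
    {K L : ℕ → Matrix n n ℝ} {D : Matrix n n ℝ} (h : IsCliffordSystem_s8 r s K L D)
    {V : Type} [AddCommGroup V] [Module ℝ V]
    {B : V →ₗ[ℝ] V →ₗ[ℝ] ℝ} {JV : (Fin (r + s) → ℝ) →ₗ[ℝ] V →ₗ[ℝ] V}
    (hV : IsMinimalAdmissible r s V B JV) (hn : Fintype.card n = Module.finrank ℝ V)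
    {X : Matrix n n ℝ} (hX : Xᵀ = X) (hK : ∀ i < r, Commute X (K i))
    (hL : ∀ i < s, Commute X (L i)) (hD : Commute X D) : ∃ c : ℝ, X = c • 1 := by
  obtain ⟨μ, v, hv, hμ⟩ := exists_eigenvector_of_transpose_eq hX
  refine ⟨μ, eq_smul_one_of_eigenSubmodule_eq_top (Submodule.eq_top_of_finrank_eq
    (le_antisymm (Submodule.finrank_le _) ?_))⟩
  rw [Module.finrank_fintype_fun_eq_card, hn]
  exact h.finrank_le hV _ (eigenSubmodule_ne_bot hv hμ)
    (fun i hi x hx => mulVec_mem_eigenSubmodule (hK i hi) hx)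
    (fun i hi x hx => mulVec_mem_eigenSubmodule (hL i hi) hx)
    (fun x hx => mulVec_mem_eigenSubmodule hD hx)

theorem finrank_le_card {n : Type} [Fintype n] [DecidableEq n] [Nonempty n]
    {K L : ℕ → Matrix n n ℝ} {D : Matrix n n ℝ} (h : IsCliffordSystem_s8 r s K L D)
    {V : Type} [AddCommGroup V] [Module ℝ V]
    {B : V →ₗ[ℝ] V →ₗ[ℝ] ℝ} {JV : (Fin (r + s) → ℝ) →ₗ[ℝ] V →ₗ[ℝ] V}
    (hV : IsMinimalAdmissible r s V B JV) : Module.finrank ℝ V ≤ Fintype.card n := by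
  have := h.finrank_le hV ⊤ top_ne_bot (fun _ _ _ _ => trivial) (fun _ _ _ _ => trivial)
    fun _ _ => trivial
  rwa [finrank_top, Module.finrank_fintype_fun_eq_card] at this

/-- If the right family has length `3` modulo `4`, its volume element is an involution splitting
the module into proper invariant subspaces of the underlying pair of families. -/
theorem finrank_lt_card {n : Type} [Fintype n] [DecidableEq n] [Nonempty n]
    {K L : ℕ → Matrix n n ℝ} {D : Matrix n n ℝ} (h : IsCliffordSystem_s8 s r L K D)
    (hs : s % 4 = 0) (hr : r % 4 = 3) {V : Type} [AddCommGroup V] [Module ℝ V]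
    {B : V →ₗ[ℝ] V →ₗ[ℝ] ℝ} {JV : (Fin (r + s) → ℝ) →ₗ[ℝ] V →ₗ[ℝ] V}
    (hV : IsMinimalAdmissible r s V B JV) : Module.finrank ℝ V < Fintype.card n := by
  have hodd : Odd r := Nat.odd_iff.2 (by omega)
  have hK : ∀ i < r, Commute (volumeProd K r) (K i) := fun i hi =>
    (h.right.commute_volumeProd hodd hi).symm
  have hL : ∀ i < s, Commute (volumeProd K r) (L i) := fun i hi =>
    (commute_volumeProd fun j hj => h.comm i hi j hj).symm
  have hsq : volumeProd K r * volumeProd K r = 1 := by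
    rw [volumeProd_mul_self h.right, if_pos (Or.inr hr)]
  have hD : D * volumeProd K r = -(volumeProd K r * D) := by
    simpa [hodd.neg_one_pow] using mul_volumeProd_of_anticommute h.anticomm_right
  generalize volumeProd K r = ω at hK hL hsq hD
  have hbot : eigenSubmodule ω 1 ≠ ⊥ := by
    obtain ⟨v, hv⟩ := exists_ne (0 : n → ℝ)
    by_cases hvω : ω *ᵥ v = v
    · exact eigenSubmodule_ne_bot hv (by rw [hvω, one_smul])
    · refine eigenSubmodule_ne_bot (v := D *ᵥ (v - ω *ᵥ v)) ?_ ?_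
      · intro h0
        have := congrArg (D *ᵥ ·) h0
        rw [Matrix.mulVec_mulVec, h.inv_mul_self, Matrix.one_mulVec, Matrix.mulVec_zero,
          sub_eq_zero] at this
        exact hvω this.symm
      · have hωD : ω * D = -(D * ω) := by rw [hD, neg_neg]
        rw [Matrix.mulVec_mulVec, hωD, Matrix.neg_mulVec, ← Matrix.mulVec_mulVec,
          Matrix.mulVec_sub, Matrix.mulVec_mulVec v, hsq, Matrix.one_mulVec, ← Matrix.mulVec_neg,
          neg_sub, one_smul]
  have htop : eigenSubmodule ω 1 ≠ ⊤ := by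
    intro ht
    have h1 := eq_smul_one_of_eigenSubmodule_eq_top ht
    rw [one_smul] at h1
    rw [h1, mul_one, one_mul] at hD
    have h2 := h.inv_mul_self
    have h0 : D = 0 := by
      ext i j
      have := congrFun₂ hD i j
      rw [Matrix.neg_apply] at this
      rw [Matrix.zero_apply]
      linarith
    rw [h0, mul_zero] at h2
    exact zero_ne_one h2
  have hle := (h.volume_left hs).finrank_le hV _ hbot
    (fun i hi x hx => mulVec_mem_eigenSubmodule (hK i hi) hx)
    (fun i hi x hx => mulVec_mem_eigenSubmodule (hL i hi) hx)
    (fun x hx => mulVec_mem_eigenSubmodule (commute_volumeProd hL) hx)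
  refine hle.trans_lt ?_
  rw [← Module.finrank_fintype_fun_eq_card (R := ℝ)]
  exact Submodule.finrank_lt htop

end IsCliffordSystem_s8

theorem IsCliffordPair.exists_pairList {R : Type*} [Ring R] [Algebra ℝ R] {j : ℕ} {K L : ℕ → R}
    (h : IsCliffordPair (2 * j) 8 K L) {gs₀ : List R} {Q₀ : ℝ} (h₀ : PairList gs₀ Q₀)
    (hK : ∀ i < 2 * j, ∀ g ∈ gs₀, Commute (K i) g) (hL : ∀ i < 8, ∀ g ∈ gs₀, Commute (L i) g) :
    ∃ gs, PairList gs (Q₀ * pairFactor j * 16) ∧ gs.length = gs₀.length + 2 * j + 8 ∧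
      (∀ A : Subalgebra ℝ R, (∀ g ∈ gs, g ∈ A) →
        (∀ g ∈ gs₀, g ∈ A) ∧ (∀ i < 2 * j, K i ∈ A) ∧ ∀ i < 8, L i ∈ A) ∧
      ∀ P : Submonoid R, (∀ g ∈ gs₀, g ∈ P) → (∀ i < 2 * j, K i ∈ P) → (∀ i < 8, L i ∈ P) →
        ∀ g ∈ gs, g ∈ P := by
  obtain ⟨gs₁, h1, hl1, hA1, hP1⟩ := h₀.extend j h.left hK
  obtain ⟨gs, h2, hl2, hA2, hP2⟩ := h1.extend (K := L) 4 h.right (by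
    intro i hi g hg
    refine Subalgebra.mem_centralizer_iff ℝ |>.1 ((hA1 (Subalgebra.centralizer ℝ {L i})).1
      ⟨fun g hg => ?_, fun l hl => ?_⟩ g hg) _ rfl
    · rw [Subalgebra.mem_centralizer_iff]
      rintro _ rfl
      exact hL i hi g hg
    · rw [Subalgebra.mem_centralizer_iff]
      rintro _ rfl
      exact (h.comm l hl i hi).symm)
  refine ⟨gs, ?_, by rw [hl2, hl1], fun A hA => ?_, fun P hg hk hl => ?_⟩
  · convert h2 using 1
    norm_num [pairFactor]
  · obtain ⟨ha, hb⟩ := (hA2 A).2 hA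
    obtain ⟨hc, hd⟩ := (hA1 A).2 ha
    exact ⟨hc, hd, hb⟩
  · exact hP2 P (hP1 P hg hk) hl

theorem IsCliffordPair.card_eq [Nonempty n] {j : ℕ} (h : IsCliffordPair (2 * j) 8 K L)
    (hKo : ∀ i < 2 * j, K i ∈ orthogonalGroup n ℝ) (hLo : ∀ i < 8, L i ∈ orthogonalGroup n ℝ)
    {gs : List (Matrix n n ℝ)} {Q : ℝ} (hgs : PairList gs Q)
    (hK : ∀ g ∈ gs, ∀ i < 2 * j, Commute (K i) g) (hL : ∀ g ∈ gs, ∀ i < 8, Commute (L i) g)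
    (ho : ∀ g ∈ gs, g ∈ orthogonalGroup n ℝ)
    (hirr : ∀ X : Matrix n n ℝ, Xᵀ = X → (∀ g ∈ gs, Commute X g) →
      (∀ i < 2 * j, Commute X (K i)) → (∀ i < 8, Commute X (L i)) → ∃ c : ℝ, X = c • 1) :
    (Fintype.card n : ℝ) ^ 2 + Q * pairFactor j * 16 * Fintype.card n
      = 2 ^ (gs.length + 2 * j + 9) := by
  obtain ⟨gs', h', hl, hA, hP⟩ := h.exists_pairList hgs (fun i hi g hg => hK g hg i hi)
    fun i hi g hg => hL g hg i hi
  have := h'.card_eq (AlgHom.id ℝ (Matrix n n ℝ))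
    (fun g hg => (mem_orthogonalGroup_iff n ℝ).1 (hP _ ho hKo hLo g hg)) fun X hX hcomm => by
      obtain ⟨h1, h2, h3⟩ := hA (Subalgebra.centralizer ℝ {X}) fun g hg => by
        rw [Subalgebra.mem_centralizer_iff]
        rintro _ rfl
        exact (hcomm g hg).symm
      simp only [Subalgebra.mem_centralizer_iff, Set.mem_singleton_iff, forall_eq] at h1 h2 h3
      exact hirr X hX h1 h2 h3
  rwa [hl] at this

theorem IsCliffordPair.exists_intertwiner {R : Type*} [Ring R] [Algebra ℝ R] [Nonempty n]
    {K L : ℕ → R} (h : IsCliffordPair r 8 K L) (hr : r % 2 = 0 ∨ r % 4 = 1)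
    (φ ψ : R →ₐ[ℝ] Matrix n n ℝ) (hK : ∀ i < r, φ (K i) ∈ orthogonalGroup n ℝ)
    (hL : ∀ i < 8, φ (L i) ∈ orthogonalGroup n ℝ) :
    ∃ X : Matrix n n ℝ, X ≠ 0 ∧ (∀ i < r, φ (K i) * X = X * ψ (K i)) ∧
      ∀ i < 8, φ (L i) * X = X * ψ (L i) := by
  obtain ⟨gs, Q, hgs, hA, ho⟩ : ∃ gs Q, PairList gs Q ∧
      (∀ A : Subalgebra ℝ R, (∀ g ∈ gs, g ∈ A) → (∀ i < r, K i ∈ A) ∧ ∀ i < 8, L i ∈ A) ∧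
      ∀ g ∈ gs, φ g ∈ orthogonalGroup n ℝ := by
    rcases hr with hr | hr
    · obtain ⟨j, rfl⟩ : ∃ j, r = 2 * j := ⟨r / 2, by omega⟩
      obtain ⟨gs, h1, -, h2, h3⟩ := h.exists_pairList PairList.nil (by simp) (by simp)
      exact ⟨gs, _, h1, fun A hA => (h2 A hA).2,
        h3 ((orthogonalGroup n ℝ).comap (φ : R →* Matrix n n ℝ)) (by simp) hK hL⟩
    · obtain ⟨j, rfl⟩ : ∃ j, r = 2 * j + 1 := ⟨r / 2, by omega⟩
      have hodd : Odd (2 * j + 1) := odd_two_mul_add_one j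
      have h' := h.mono (r' := 2 * j) (by omega)
      have hz : volumeProd K (2 * j + 1) * volumeProd K (2 * j + 1) = -1 := by
        rw [volumeProd_mul_self h.left, if_neg (by omega)]
      obtain ⟨gs, h1, -, h2, h3⟩ := h'.exists_pairList (PairList.central _ hz)
        (by simpa using fun i hi => h.left.commute_volumeProd hodd (by omega))
        (by simpa using fun i hi => commute_volumeProd fun l hl => (h.comm l hl i hi).symm)
      refine ⟨gs, _, h1, fun A hA => ?_, ?_⟩
      · obtain ⟨ha, hb, hc⟩ := h2 A hA
        refine ⟨fun i hi => ?_, hc⟩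
        rcases Nat.lt_succ_iff_lt_or_eq.1 hi with hi | rfl
        · exact hb i hi
        · have hω : volumeProd K (2 * j) ∈ A := volumeProd_mem (A := A.toSubmonoid) hb
          have := A.mul_mem hω (ha (volumeProd K (2 * j + 1)) (by simp))
          rwa [volumeProd, ← mul_assoc, volumeProd_mul_self h'.left, if_pos (by omega),
            one_mul] at this
      · have hK' : ∀ i < 2 * j + 1, K i ∈ (orthogonalGroup n ℝ).comap (φ : R →* Matrix n n ℝ) :=
          hK
        exact h3 ((orthogonalGroup n ℝ).comap (φ : R →* Matrix n n ℝ))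
          (by simpa using volumeProd_mem hK') (fun i hi => hK i (by omega)) hL
  obtain ⟨X, hX, hint⟩ := hgs.exists_intertwiner φ ψ fun g hg =>
    (mem_orthogonalGroup_iff n ℝ).1 (ho g hg)
  obtain ⟨h1, h2⟩ := hA (Algebra.adjoin ℝ {g | g ∈ gs}) fun g hg => Algebra.subset_adjoin hg
  exact ⟨X, hX, fun i hi => intertwines_of_mem_adjoin φ ψ hint (h1 i hi),
    fun i hi => intertwines_of_mem_adjoin φ ψ hint (h2 i hi)⟩

end CliffordSystem

section Dimension

open Matrix

variable {n : Type} [Fintype n] [DecidableEq n] [Nonempty n] {r : ℕ} {K L : ℕ → Matrix n n ℝ}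
  {D : Matrix n n ℝ} {V : Type} [AddCommGroup V] [Module ℝ V] {B : V →ₗ[ℝ] V →ₗ[ℝ] ℝ}

namespace IsCliffordSystem_s8

theorem card_eq_of_even {JV : (Fin (r + 8) → ℝ) →ₗ[ℝ] V →ₗ[ℝ] V}
    (h : IsCliffordSystem_s8 r 8 K L D) (hV : IsMinimalAdmissible r 8 V B JV)
    (hn : Fintype.card n = Module.finrank ℝ V) {j : ℕ} (hr : r = 2 * j) :
    (Fintype.card n : ℝ) ^ 2 + pairFactor j * 16 * Fintype.card n = 2 ^ (r + 9) := by
  subst hr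
  have := h.pair.card_eq (fun i hi => h.left_mem hi) (fun i hi => h.right_mem hi) PairList.nil
    (by simp) (by simp) (by simp) fun X hX _ hK hL =>
      (h.volume_right (by norm_num)).exists_eq_smul_one hV hn hX hK hL (commute_volumeProd hL)
  simpa using this

theorem card_sq_of_mod_four_eq_one {JV : (Fin (r + 8) → ℝ) →ₗ[ℝ] V →ₗ[ℝ] V}
    (h : IsCliffordSystem_s8 r 8 K L D) (hV : IsMinimalAdmissible r 8 V B JV)
    (hn : Fintype.card n = Module.finrank ℝ V) (hr : r % 4 = 1) :
    (Fintype.card n : ℝ) ^ 2 = 2 ^ (r + 9) := by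
  obtain ⟨j, rfl⟩ : ∃ j, r = 2 * j + 1 := ⟨r / 2, by omega⟩
  have hodd : Odd (2 * j + 1) := odd_two_mul_add_one j
  have hp := h.pair.mono (r' := 2 * j) (by omega)
  have hω : volumeProd K (2 * j) * volumeProd K (2 * j) = 1 := by
    rw [volumeProd_mul_self hp.left, if_pos (by omega)]
  have hz : volumeProd K (2 * j + 1) * volumeProd K (2 * j + 1) = -1 := by
    rw [volumeProd_mul_self h.left, if_neg (by omega)]
  have := hp.card_eq (fun i hi => h.left_mem (by omega)) (fun i hi => h.right_mem hi)
    (PairList.central _ hz)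
    (by simpa using fun i hi => h.left.commute_volumeProd hodd (by omega))
    (by simpa using fun i hi => commute_volumeProd fun l hl => (h.comm l hl i hi).symm)
    (by simpa using volumeProd_mem fun i hi => h.left_mem hi) fun X hX hz hK hL => by
      refine (h.volume_right (by norm_num)).exists_eq_smul_one hV hn hX (fun i hi => ?_) hL
        (commute_volumeProd hL)
      rcases Nat.lt_succ_iff_lt_or_eq.1 hi with hi | rfl
      · exact hK i hi
      · have := (commute_volumeProd hK).mul_right (hz (volumeProd K (2 * j + 1)) (by simp))
        rwa [volumeProd, ← mul_assoc, hω, one_mul] at this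
  rw [zero_mul, zero_mul, zero_mul, add_zero] at this
  rw [this, List.length_singleton]
  ring

theorem card_sq_of_mod_four_eq_two {JV : (Fin (8 + r) → ℝ) →ₗ[ℝ] V →ₗ[ℝ] V}
    (h : IsCliffordSystem_s8 8 r L K D) (hV : IsMinimalAdmissible 8 r V B JV)
    (hn : Fintype.card n = Module.finrank ℝ V) (hr : r % 4 = 2) :
    (Fintype.card n : ℝ) ^ 2 = 2 ^ (r + 10) := by
  obtain ⟨j, rfl⟩ : ∃ j, r = 2 * j := ⟨r / 2, by omega⟩
  have hω : volumeProd K (2 * j) * volumeProd K (2 * j) = -1 := by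
    rw [volumeProd_mul_self h.right, if_neg (by omega)]
  have hωD : Commute D (volumeProd K (2 * j)) :=
    commute_volumeProd_of_anticommute (even_two_mul j) h.anticomm_right
  have hz : volumeProd K (2 * j) * D * (volumeProd K (2 * j) * D) = -1 := by
    rw [mul_assoc, ← mul_assoc D, hωD.eq, mul_assoc, h.inv_mul_self, mul_one, hω]
  have := h.pair.swap.card_eq (fun i hi => h.right_mem hi) (fun i hi => h.left_mem hi)
    (PairList.central _ hz)
    (by
      simp only [List.mem_singleton, forall_eq]
      intro i hi
      have e1 := h.right.anticommute_volumeProd (even_two_mul j) hi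
      have e2 := h.anticomm_right i hi
      rw [commute_iff_eq, ← mul_assoc, e1, mul_assoc, e2, neg_mul, mul_neg, mul_assoc])
    (by simpa using fun i hi => (commute_volumeProd fun l hl => h.comm i hi l hl).mul_right
          (h.comm_left i hi).symm)
    (by simpa using mul_mem (volumeProd_mem fun i hi => h.right_mem hi) h.inv_mem)
    fun X hX hz hK hL => by
      refine h.exists_eq_smul_one hV hn hX hL hK ?_
      have := (commute_volumeProd hK).mul_right (hz (volumeProd K (2 * j) * D) (by simp))
      replace this := this.neg_right
      rwa [← mul_assoc, hω, neg_one_mul, neg_neg] at this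
  rw [zero_mul, zero_mul, zero_mul, add_zero] at this
  rw [this, List.length_singleton]
  ring

theorem card_eq_of_mod_four_eq_one {JV : (Fin (8 + r) → ℝ) →ₗ[ℝ] V →ₗ[ℝ] V}
    (h : IsCliffordSystem_s8 8 r L K D) (hV : IsMinimalAdmissible 8 r V B JV)
    (hn : Fintype.card n = Module.finrank ℝ V) (hr : r % 4 = 1) {j : ℕ} (hj : r = 2 * j + 1) :
    (Fintype.card n : ℝ) ^ 2 + 2 * pairFactor j * 16 * Fintype.card n = 2 ^ (r + 10) := by
  subst hj
  have hodd : Odd (2 * j + 1) := odd_two_mul_add_one j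
  have heven := even_two_mul j
  have hp := h.pair.swap.mono (r' := 2 * j) (by omega)
  have hω : volumeProd K (2 * j) * volumeProd K (2 * j) = 1 := by
    rw [volumeProd_mul_self hp.left, if_pos (by omega)]
  have ha : volumeProd K (2 * j + 1) * volumeProd K (2 * j + 1) = (-1 : ℝ) • 1 := by
    rw [volumeProd_mul_self h.right, if_neg (by omega), neg_one_smul]
  have hωD : Commute D (volumeProd K (2 * j)) :=
    commute_volumeProd_of_anticommute heven fun i hi => h.anticomm_right i (by omega)
  have hb : volumeProd K (2 * j) * D * (volumeProd K (2 * j) * D) = (1 : ℝ) • 1 := by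
    rw [mul_assoc, ← mul_assoc D, hωD.eq, mul_assoc, h.inv_mul_self, mul_one, hω, one_smul]
  have hωK : Commute (K (2 * j)) (volumeProd K (2 * j)) :=
    commute_volumeProd_of_anticommute heven fun i hi =>
      h.right.2 _ (by omega) i (by omega) (by omega)
  have hab : volumeProd K (2 * j + 1) * (volumeProd K (2 * j) * D)
      = -(volumeProd K (2 * j) * D * volumeProd K (2 * j + 1)) := by
    have e1 : volumeProd K (2 * j + 1) * (volumeProd K (2 * j) * D) = K (2 * j) * D := by
      rw [volumeProd, ← hωK.eq, mul_assoc, ← mul_assoc (volumeProd K _), hω, one_mul]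
    have e2 : volumeProd K (2 * j) * D * volumeProd K (2 * j + 1) = D * K (2 * j) := by
      rw [volumeProd, ← hωD.eq, mul_assoc, ← mul_assoc (volumeProd K _), hω, one_mul]
    rw [e1, e2, h.anticomm_right _ (by omega), neg_neg]
  have hgs := PairList.pair [] 1 _ _ (-1) 1 PairList.nil (by simp) (by simp) hab (Or.inr rfl)
    (Or.inl rfl) ha hb
  have := hp.card_eq (fun i hi => h.right_mem (by omega)) (fun i hi => h.left_mem hi) hgs
    (by
      simp only [List.mem_cons, List.not_mem_nil, or_false, forall_eq_or_imp, forall_eq]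
      refine ⟨fun i hi => h.right.commute_volumeProd hodd (by omega), fun i hi => ?_⟩
      have e1 := hp.left.anticommute_volumeProd heven hi
      have e2 := h.anticomm_right i (by omega)
      rw [commute_iff_eq, ← mul_assoc, e1, mul_assoc, e2, neg_mul, mul_neg, mul_assoc])
    (by
      simp only [List.mem_cons, List.not_mem_nil, or_false, forall_eq_or_imp, forall_eq]
      exact ⟨fun i hi => commute_volumeProd fun l hl => h.comm i hi l hl,
        fun i hi => (commute_volumeProd fun l hl => h.comm i hi l (by omega)).mul_right
          (h.comm_left i hi).symm⟩)
    (by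
      simp only [List.mem_cons, List.not_mem_nil, or_false, forall_eq_or_imp, forall_eq]
      exact ⟨volumeProd_mem fun i hi => h.right_mem hi,
        mul_mem (volumeProd_mem fun i hi => h.right_mem (by omega)) h.inv_mem⟩)
    fun X hX hX' hK hL => by
      simp only [List.mem_cons, List.not_mem_nil, or_false, forall_eq_or_imp, forall_eq] at hX'
      refine h.exists_eq_smul_one hV hn hX hL (fun i hi => ?_) ?_
      · rcases Nat.lt_succ_iff_lt_or_eq.1 hi with hi | rfl
        · exact hK i hi
        · have := (commute_volumeProd hK).mul_right hX'.1
          rwa [volumeProd, ← mul_assoc, hω, one_mul] at this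
      · have := (commute_volumeProd hK).mul_right hX'.2
        rwa [← mul_assoc, hω, one_mul] at this
  rw [show (1 : ℝ) * (1 + -1 + 1 - -1 * 1) = 2 by norm_num] at this
  rw [this]
  simp only [List.length_cons, List.length_nil]
  ring

end IsCliffordSystem_s8

end Dimension

section Isomorphism

open Matrix Module

theorem IsMinimalAdmissible.finrank_pos {r s : ℕ} {V : Type} [AddCommGroup V] [Module ℝ V]
    {B : V →ₗ[ℝ] V →ₗ[ℝ] ℝ} {J : (Fin (r + s) → ℝ) →ₗ[ℝ] V →ₗ[ℝ] V}
    (hV : IsMinimalAdmissible r s V B J) : 0 < finrank ℝ V := by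
  obtain ⟨⟨_, _, -⟩, -⟩ := hV
  exact Module.finrank_pos

section Rank

variable {r : ℕ} {V₁ : Type} [AddCommGroup V₁] [Module ℝ V₁] {B₁ : V₁ →ₗ[ℝ] V₁ →ₗ[ℝ] ℝ}
  {J₁ : (Fin (r + 8) → ℝ) →ₗ[ℝ] V₁ →ₗ[ℝ] V₁} {V₂ : Type} [AddCommGroup V₂] [Module ℝ V₂]
  {B₂ : V₂ →ₗ[ℝ] V₂ →ₗ[ℝ] ℝ} {J₂ : (Fin (8 + r) → ℝ) →ₗ[ℝ] V₂ →ₗ[ℝ] V₂}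

theorem IsMinimalAdmissible.finrank_eq_iff (h₁ : IsMinimalAdmissible r 8 V₁ B₁ J₁)
    (h₂ : IsMinimalAdmissible 8 r V₂ B₂ J₂) :
    finrank ℝ V₁ = finrank ℝ V₂ ↔ r % 8 = 0 ∨ r % 8 = 1 ∨ r % 8 = 2 ∨ r % 8 = 4 := by
  have p₁ := h₁.finrank_pos
  have p₂ := h₂.finrank_pos
  have : Nonempty (Fin (finrank ℝ V₁)) := ⟨⟨0, p₁⟩⟩
  have : Nonempty (Fin (finrank ℝ V₂)) := ⟨⟨0, p₂⟩⟩
  obtain ⟨K₁, L₁, D₁, -, -, -, s₁, -⟩ := h₁.exists_cliffordSystem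
  obtain ⟨L₂, K₂, D₂, -, -, -, s₂, -⟩ := h₂.exists_cliffordSystem
  have c₁ := Fintype.card_fin (finrank ℝ V₁)
  have c₂ := Fintype.card_fin (finrank ℝ V₂)
  have q₁ : (0 : ℝ) < finrank ℝ V₁ := by exact_mod_cast p₁
  have q₂ : (0 : ℝ) < finrank ℝ V₂ := by exact_mod_cast p₂
  have even : ∀ j, r = 2 * j → _ := fun j => s₁.card_eq_of_even h₁ c₁
  have odd₁ := s₁.card_sq_of_mod_four_eq_one h₁ c₁
  have odd₂ : r % 4 = 1 → ∀ j, r = 2 * j + 1 → _ :=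
    fun hr j => s₂.card_eq_of_mod_four_eq_one h₂ c₂ hr
  have two := s₂.card_sq_of_mod_four_eq_two h₂ c₂
  rw [c₁] at even odd₁
  rw [c₂] at odd₂ two
  have hle : finrank ℝ V₁ ≤ finrank ℝ V₂ :=
    ((s₂.volume_left (by norm_num)).finrank_le_card h₁).trans c₂.le
  obtain ⟨k, hk⟩ : ∃ k, r / 8 = k := ⟨_, rfl⟩
  have ht : (0 : ℝ) < 16 ^ k := by positivity
  have hpow : ∀ i, (2 : ℝ) ^ (8 * k + i) = 16 ^ k * 16 ^ k * 2 ^ i := fun i => by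
    rw [pow_add, pow_mul, ← mul_pow]; norm_num
  have hne : (finrank ℝ V₁ : ℝ) ≠ finrank ℝ V₂ → finrank ℝ V₁ ≠ finrank ℝ V₂ :=
    fun h h' => h (by rw [h'])
  have cases : r % 8 = 0 ∨ r % 8 = 1 ∨ r % 8 = 2 ∨ r % 8 = 3 ∨ r % 8 = 4 ∨ r % 8 = 5 ∨
    r % 8 = 6 ∨ r % 8 = 7 := by omega
  have zero : r % 4 = 0 → finrank ℝ V₁ = finrank ℝ V₂ := fun hr =>
    hle.antisymm (((s₁.volume_left hr).finrank_le_card h₂).trans c₁.le)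
  have three : r % 4 = 3 → finrank ℝ V₁ ≠ finrank ℝ V₂ := fun hr =>
    ((s₂.finrank_lt_card (by norm_num) hr h₁).trans_eq c₂).ne
  have sq : ∀ a b : ℝ, 0 < a → 0 < b → a ^ 2 = b ^ 2 → a = b := fun a b ha hb =>
    (pow_left_inj₀ ha.le hb.le two_ne_zero).1
  rcases cases with h | h | h | h | h | h | h | h
  · exact iff_of_true (zero (by omega)) (by omega)
  · refine iff_of_true ?_ (by omega)
    have e₁ := odd₁ (by omega)
    have e₂ := odd₂ (by omega) (4 * k + 0) (by omega)
    rw [show r + 9 = 8 * k + 10 by omega, hpow] at e₁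
    rw [show r + 10 = 8 * k + 11 by omega, hpow, pairFactor_four_mul_add] at e₂
    norm_num [pairFactor] at e₁ e₂
    have e₃ := sq _ (32 * 16 ^ k) q₁ (by positivity) (by rw [e₁]; ring)
    have e₄ : ((finrank ℝ V₂ : ℝ) - 32 * 16 ^ k) * (finrank ℝ V₂ + 64 * 16 ^ k) = 0 := by
      linear_combination e₂
    rcases mul_eq_zero.1 e₄ with e | e
    · exact_mod_cast e₃.trans (sub_eq_zero.1 e).symm
    · exact absurd e (by positivity)
  · refine iff_of_true ?_ (by omega)
    have e₁ := even (4 * k + 1) (by omega)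
    have e₂ := two (by omega)
    rw [show r + 9 = 8 * k + 11 by omega, hpow, pairFactor_four_mul_add] at e₁
    rw [show r + 10 = 8 * k + 12 by omega, hpow] at e₂
    norm_num [pairFactor] at e₁ e₂
    have e₃ := sq _ (64 * 16 ^ k) q₂ (by positivity) (by rw [e₂]; ring)
    have e₄ : ((finrank ℝ V₁ : ℝ) - 64 * 16 ^ k) * (finrank ℝ V₁ + 32 * 16 ^ k) = 0 := by
      linear_combination e₁
    rcases mul_eq_zero.1 e₄ with e | e
    · exact_mod_cast (sub_eq_zero.1 e).trans e₃.symm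
    · exact absurd e (by positivity)
  · exact iff_of_false (three (by omega)) (by omega)
  · exact iff_of_true (zero (by omega)) (by omega)
  · refine iff_of_false (hne fun e => ?_) (by omega)
    have e₁ := odd₁ (by omega)
    have e₂ := odd₂ (by omega) (4 * k + 2) (by omega)
    rw [show r + 9 = 8 * k + 14 by omega, hpow] at e₁
    rw [show r + 10 = 8 * k + 15 by omega, hpow, pairFactor_four_mul_add, ← e] at e₂
    norm_num [pairFactor] at e₁ e₂
    have := sq _ (128 * 16 ^ k) q₁ (by positivity) (by rw [e₁]; ring)
    rw [this] at e₂
    nlinarith [mul_pos ht ht]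
  · refine iff_of_false (hne fun e => ?_) (by omega)
    have e₁ := even (4 * k + 3) (by omega)
    have e₂ := two (by omega)
    rw [show r + 9 = 8 * k + 15 by omega, hpow, pairFactor_four_mul_add, e] at e₁
    rw [show r + 10 = 8 * k + 16 by omega, hpow] at e₂
    norm_num [pairFactor] at e₁ e₂
    have := sq _ (256 * 16 ^ k) q₂ (by positivity) (by rw [e₂]; ring)
    rw [this] at e₁
    nlinarith [mul_pos ht ht]
  · exact iff_of_false (three (by omega)) (by omega)

end Rank

theorem IsCliffordFamily.prodMk {R S : Type*} [Ring R] [Ring S] {r : ℕ} {K : ℕ → R} {K' : ℕ → S}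
    (h : IsCliffordFamily r K) (h' : IsCliffordFamily r K') :
    IsCliffordFamily r fun i => (K i, K' i) :=
  ⟨fun i hi => Prod.ext (h.1 i hi) (h'.1 i hi),
    fun i hi j hj hij => Prod.ext (h.2 i hi j hj hij) (h'.2 i hi j hj hij)⟩

theorem IsCliffordPair.prodMk {R S : Type*} [Ring R] [Ring S] {r s : ℕ} {K L : ℕ → R}
    {K' L' : ℕ → S} (h : IsCliffordPair r s K L) (h' : IsCliffordPair r s K' L') :
    IsCliffordPair r s (fun i => (K i, K' i)) fun i => (L i, L' i) :=
  ⟨h.left.prodMk h'.left, h.right.prodMk h'.right,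
    fun i hi j hj => Prod.ext (h.comm i hi j hj) (h'.comm i hi j hj)⟩

theorem joinFamily_castAdd {R : Type*} {r s : ℕ} (K L : ℕ → R) (i : Fin r) :
    joinFamily r s K L (Fin.castAdd s i) = K i := by
  simp [joinFamily]

theorem joinFamily_natAdd {R : Type*} {r s : ℕ} (K L : ℕ → R) (i : Fin s) :
    joinFamily r s K L (Fin.natAdd r i) = L i := by
  simp [joinFamily]

theorem Matrix.transpose_mul_eq_of_mul_eq {n : Type*} [Fintype n] {M N X : Matrix n n ℝ}
    (hM : Mᵀ = -M) (hN : Nᵀ = -N) (h : M * X = X * N) : N * Xᵀ = Xᵀ * M := by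
  have := congrArg transpose h
  rwa [transpose_mul, transpose_mul, hM, hN, mul_neg, neg_mul, neg_inj, eq_comm] at this

theorem IsCliffordSystem_s8.exists_similarity {n : Type} [Fintype n] [DecidableEq n] [Nonempty n]
    {r : ℕ} {K₁ L₁ D₁ K₂ L₂ D₂} (s₁ : IsCliffordSystem_s8 (n := n) r 8 K₁ L₁ D₁)
    (s₂ : IsCliffordSystem_s8 (n := n) 8 r L₂ K₂ D₂) (hr : r % 2 = 0 ∨ r % 4 = 1)
    {V : Type} [AddCommGroup V] [Module ℝ V] {B : V →ₗ[ℝ] V →ₗ[ℝ] ℝ}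
    {J : (Fin (r + 8) → ℝ) →ₗ[ℝ] V →ₗ[ℝ] V} (hV : IsMinimalAdmissible r 8 V B J)
    (hn : Fintype.card n = finrank ℝ V) :
    ∃ (Y : Matrix n n ℝ) (μ : ℝ), μ ≠ 0 ∧ Yᵀ * Y = μ • 1 ∧
      ∀ i, joinFamily 8 r L₂ K₂ i * Y = Y * joinFamily r 8 K₁ L₁ (finAddFlip i) := by
  obtain ⟨X, hX, hK, hL⟩ := (s₁.pair.prodMk s₂.pair.swap).exists_intertwiner hr
    (AlgHom.fst ℝ _ _) (AlgHom.snd ℝ _ _) (fun i hi => s₁.left_mem hi)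
    (fun i hi => s₁.right_mem hi)
  simp only [AlgHom.fst_apply, AlgHom.snd_apply] at hK hL
  have hK' : ∀ i < r, K₂ i * Xᵀ = Xᵀ * K₁ i := fun i hi =>
    transpose_mul_eq_of_mul_eq (s₁.transpose_left i hi) (s₂.transpose_right i hi) (hK i hi)
  have hL' : ∀ i < 8, L₂ i * Xᵀ = Xᵀ * L₁ i := fun i hi =>
    transpose_mul_eq_of_mul_eq (s₁.transpose_right i hi) (s₂.transpose_left i hi) (hL i hi)
  have hXL : ∀ i < 8, Commute (X * Xᵀ) (L₁ i) := fun i hi => by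
    rw [commute_iff_eq, mul_assoc, ← hL' i hi, ← mul_assoc, ← hL i hi, mul_assoc]
  obtain ⟨μ, hμ⟩ := (s₁.volume_right (by norm_num)).exists_eq_smul_one hV hn (X := X * Xᵀ)
    (by simp) (fun i hi => by
      rw [commute_iff_eq, mul_assoc, ← hK' i hi, ← mul_assoc, ← hK i hi, mul_assoc])
    hXL (commute_volumeProd hXL)
  refine ⟨Xᵀ, μ, ?_, hμ, fun i => ?_⟩
  · rintro rfl
    rw [zero_smul] at hμ
    exact hX (by simpa using Matrix.self_mul_conjTranspose_eq_zero.1 hμ)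
  · induction i using Fin.addCases with
    | left i => simpa [joinFamily_castAdd, joinFamily_natAdd] using hL' i i.2
    | right i => simpa [joinFamily_castAdd, joinFamily_natAdd] using hK' i i.2

theorem IsHBracket.apply_eq {r s : ℕ} {V : Type} [AddCommGroup V] [Module ℝ V]
    {B : V →ₗ[ℝ] V →ₗ[ℝ] ℝ} {J : (Fin (r + s) → ℝ) →ₗ[ℝ] V →ₗ[ℝ] V}
    {br : V →ₗ[ℝ] V →ₗ[ℝ] (Fin (r + s) → ℝ)} (h : IsHBracket r s V B J br) (v w : V)
    (i : Fin (r + s)) :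
    br v w i = (if (i : ℕ) < r then (1 : ℝ) else -1) * B (J (Pi.single i 1) v) w := by
  rw [← h, sform_single_left, ← mul_assoc]
  split_ifs <;> simp

theorem exists_isLieIso {r : ℕ} {V₁ : Type} [AddCommGroup V₁] [Module ℝ V₁]
    {B₁ : V₁ →ₗ[ℝ] V₁ →ₗ[ℝ] ℝ} {J₁ : (Fin (r + 8) → ℝ) →ₗ[ℝ] V₁ →ₗ[ℝ] V₁}
    {br₁ : V₁ →ₗ[ℝ] V₁ →ₗ[ℝ] (Fin (r + 8) → ℝ)} {V₂ : Type} [AddCommGroup V₂] [Module ℝ V₂]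
    {B₂ : V₂ →ₗ[ℝ] V₂ →ₗ[ℝ] ℝ} {J₂ : (Fin (8 + r) → ℝ) →ₗ[ℝ] V₂ →ₗ[ℝ] V₂}
    {br₂ : V₂ →ₗ[ℝ] V₂ →ₗ[ℝ] (Fin (8 + r) → ℝ)} (h₁ : IsMinimalAdmissible r 8 V₁ B₁ J₁)
    (hbr₁ : IsHBracket r 8 V₁ B₁ J₁ br₁) (h₂ : IsMinimalAdmissible 8 r V₂ B₂ J₂)
    (hbr₂ : IsHBracket 8 r V₂ B₂ J₂ br₂) (hd : finrank ℝ V₁ = finrank ℝ V₂)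
    (hr : r % 2 = 0 ∨ r % 4 = 1) :
    ∃ f : (V₁ × (Fin (r + 8) → ℝ)) ≃ₗ[ℝ] (V₂ × (Fin (8 + r) → ℝ)), IsLieIso br₁ br₂ f := by
  have p₁ := h₁.finrank_pos
  have : Nonempty (Fin (finrank ℝ V₁)) := ⟨⟨0, p₁⟩⟩
  have hsys := h₂.exists_cliffordSystem
  rw [← hd] at hsys
  have : Nonempty (Fin (finrank ℝ V₁)) := ⟨⟨0, p₁⟩⟩
  have hsys := h₂.exists_cliffordSystem
  rw [← hd] at hsys
  obtain ⟨K₁, L₁, D₁, e₁, c₁, hc₁, s₁, hB₁⟩ := h₁.exists_cliffordSystem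
  obtain ⟨L₂, K₂, D₂, e₂, c₂, hc₂, s₂, hB₂⟩ := hsys
  obtain ⟨Y, μ, hμ, hY, hJ⟩ := s₁.exists_similarity s₂ hr h₁ (Fintype.card_fin _)
  have hY₁ : μ⁻¹ • Yᵀ * Y = 1 := by
    rw [smul_mul_assoc, hY, smul_smul, inv_mul_cancel₀ hμ, one_smul]
  let A : V₁ ≃ₗ[ℝ] V₂ :=
    e₁ ≪≫ₗ toLin'OfInv hY₁ (mul_eq_one_comm.1 hY₁) ≪≫ₗ e₂.symm
  have hA : ∀ v, e₂ (A v) = Y *ᵥ e₁ v := fun v =>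
    e₂.apply_symm_apply _
  have hAB : ∀ i v w, B₂ (J₂ (Pi.single i 1) (A v)) (A w)
      = c₂ * μ / c₁ * B₁ (J₁ (Pi.single (finAddFlip i) 1) v) w := fun i v w => by
    rw [hB₂, hB₁, hA, hA, mulVec_mulVec, hJ, ← mulVec_mulVec, dotProduct_mulVec,
      ← mulVec_transpose, mulVec_mulVec, hY, smul_mulVec, one_mulVec, smul_dotProduct, smul_eq_mul]
    field_simp
  have hν : -(c₂ * μ / c₁) ≠ 0 := neg_ne_zero.2 (div_ne_zero (mul_ne_zero hc₂ hμ) hc₁)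
  let C : (Fin (r + 8) → ℝ) ≃ₗ[ℝ] (Fin (8 + r) → ℝ) :=
    LinearEquiv.funCongrLeft ℝ ℝ finAddFlip ≪≫ₗ LinearEquiv.smulOfNeZero ℝ _ _ hν
  refine ⟨A.prodCongr C, fun x y => Prod.ext (map_zero A) (funext fun i => ?_)⟩
  change -(c₂ * μ / c₁) * br₁ x.1 y.1 (finAddFlip i) = br₂ (A x.1) (A y.1) i
  rw [hbr₁.apply_eq, hbr₂.apply_eq, hAB]
  induction i using Fin.addCases with
  | left i => simp
  | right i => simp

end Isomorphism

theorem stmt8 (r : ℕ) (hr : 1 ≤ r)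
    (V1 : Type) [AddCommGroup V1] [Module ℝ V1]
    (B1 : V1 →ₗ[ℝ] V1 →ₗ[ℝ] ℝ)
    (J1 : (Fin (r + 8) → ℝ) →ₗ[ℝ] V1 →ₗ[ℝ] V1)
    (br1 : V1 →ₗ[ℝ] V1 →ₗ[ℝ] (Fin (r + 8) → ℝ))
    (hadm1 : IsMinimalAdmissible r 8 V1 B1 J1)
    (hbr1 : IsHBracket r 8 V1 B1 J1 br1)
    (V2 : Type) [AddCommGroup V2] [Module ℝ V2]
    (B2 : V2 →ₗ[ℝ] V2 →ₗ[ℝ] ℝ)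
    (J2 : (Fin (8 + r) → ℝ) →ₗ[ℝ] V2 →ₗ[ℝ] V2)
    (br2 : V2 →ₗ[ℝ] V2 →ₗ[ℝ] (Fin (8 + r) → ℝ))
    (hadm2 : IsMinimalAdmissible 8 r V2 B2 J2)
    (hbr2 : IsHBracket 8 r V2 B2 J2 br2)
    :
    (∃ f : (V1 × (Fin (r + 8) → ℝ)) ≃ₗ[ℝ] (V2 × (Fin (8 + r) → ℝ)),
      IsLieIso br1 br2 f) ↔
    (r % 8 = 0 ∨ r % 8 = 1 ∨ r % 8 = 2 ∨ r % 8 = 4) := by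
  rw [← hadm1.finrank_eq_iff hadm2]
  constructor
  · rintro ⟨f, -⟩
    obtain ⟨⟨_, -⟩, -⟩ := hadm1
    obtain ⟨⟨_, -⟩, -⟩ := hadm2
    have := f.finrank_eq
    simp only [Module.finrank_prod, Module.finrank_fin_fun] at this
    omega
  · intro hd
    have hmod := (hadm1.finrank_eq_iff hadm2).1 hd
    exact exists_isLieIso hadm1 hbr1 hadm2 hbr2 hd (by omega)
end
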